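/- arXiv:0710.3032 — 2 statements merged into one kernel-verified Lean document; each statement's English description precedes it below -/
import Mathlib

section
/- For every δ > 0, every positive integer r and every finite subset X ⊆ ℤ^r there is a positive integer N such that every subset A of the grid {1,2,…,N}^r of size at least δN^r contains a subset of the form a + dX = {a + dx : x ∈ X} for some a ∈ ℤ^r and some positive integer d. (The multidimensional Szemerédi theorem, Theorem 10.3.) -/
open Finset

namespace DensityHalesJewett

open Combinatorics

/-- The average of a real function over a finite type. -/
noncomputable def avg {X : Type*} (f : X → ℝ) : ℝ := (∑ᶠ x, f x) / Nat.card X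

/-- The density of a subset of a finite type. -/
noncomputable def dens {X : Type*} (A : Set X) : ℝ := avg (A.indicator 1)

section Average

variable {X Y : Type*}

lemma avg_eq_sum_div [Fintype X] (f : X → ℝ) : avg f = (∑ x, f x) / Fintype.card X := by
  rw [avg, finsum_eq_sum_of_fintype, Nat.card_eq_fintype_card]

lemma avg_equiv (e : X ≃ Y) (f : Y → ℝ) : avg (fun x ↦ f (e x)) = avg f := by
  rw [avg, avg, Nat.card_congr e, finsum_comp_equiv e]

lemma nonempty_of_dens_pos {A : Set X} (h : 0 < dens A) : A.Nonempty := by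
  by_contra! h0
  simp [h0, dens, avg] at h

variable [Finite X] [Finite Y]

lemma avg_mono {f g : X → ℝ} (h : ∀ x, f x ≤ g x) : avg f ≤ avg g := by
  have := Fintype.ofFinite X
  rw [avg_eq_sum_div, avg_eq_sum_div]
  gcongr with x
  exact h x

lemma avg_add (f g : X → ℝ) : avg (fun x ↦ f x + g x) = avg f + avg g := by
  have := Fintype.ofFinite X
  simp only [avg_eq_sum_div, sum_add_distrib, add_div]

lemma avg_sub (f g : X → ℝ) : avg (fun x ↦ f x - g x) = avg f - avg g := by
  have := Fintype.ofFinite X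
  simp only [avg_eq_sum_div, sum_sub_distrib, sub_div]

lemma avg_const_mul (c : ℝ) (f : X → ℝ) : avg (fun x ↦ c * f x) = c * avg f := by
  have := Fintype.ofFinite X
  simp only [avg_eq_sum_div, ← mul_sum, mul_div_assoc]

lemma avg_sum {ι : Type*} (s : Finset ι) (f : ι → X → ℝ) :
    avg (fun x ↦ ∑ i ∈ s, f i x) = ∑ i ∈ s, avg (f i) := by
  have := Fintype.ofFinite X
  simp only [avg_eq_sum_div, ← sum_div]
  rw [sum_comm]

lemma avg_const [Nonempty X] (c : ℝ) : avg (fun _ : X ↦ c) = c := by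
  have := Fintype.ofFinite X
  simp [avg_eq_sum_div]

lemma avg_const_le {c : ℝ} (hc : 0 ≤ c) : avg (fun _ : X ↦ c) ≤ c := by
  cases isEmpty_or_nonempty X
  · simpa [avg] using hc
  · rw [avg_const]

lemma avg_prod (f : X × Y → ℝ) : avg f = avg fun x ↦ avg fun y ↦ f (x, y) := by
  have := Fintype.ofFinite X
  have := Fintype.ofFinite Y
  simp only [avg_eq_sum_div, ← sum_div, Fintype.sum_prod_type, Fintype.card_prod, Nat.cast_mul]
  rw [div_div, mul_comm]

lemma avg_comm (f : X → Y → ℝ) :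
    avg (fun x ↦ avg fun y ↦ f x y) = avg fun y ↦ avg fun x ↦ f x y := by
  have h := avg_equiv (Equiv.prodComm X Y) fun p : Y × X ↦ f p.2 p.1
  rw [avg_prod, avg_prod] at h
  exact h

lemma avg_sumElim {ι κ β : Type*} [Finite ι] [Finite κ] [Finite β] (f : (ι ⊕ κ → β) → ℝ) :
    avg f = avg fun t : ι → β ↦ avg fun w : κ → β ↦ f (Sum.elim t w) := by
  rw [← avg_equiv (Equiv.sumArrowEquivProdArrow ι κ β).symm, avg_prod]
  rfl

lemma le_card_mul_avg {f : X → ℝ} (h : ∀ x, 0 ≤ f x) (x : X) : f x ≤ Nat.card X * avg f := by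
  have := Fintype.ofFinite X
  have : Nonempty X := ⟨x⟩
  rw [avg_eq_sum_div, Nat.card_eq_fintype_card, mul_div_cancel₀ _ (by positivity)]
  exact single_le_sum (fun y _ ↦ h y) (mem_univ x)

lemma avg_indicator_range {g : Y → X} (hg : g.Injective) (f : X → ℝ) :
    avg ((Set.range g).indicator f) = Nat.card Y / Nat.card X * avg fun y ↦ f (g y) := by
  classical
  have := Fintype.ofFinite X
  have := Fintype.ofFinite Y
  have h : ∑ x, (Set.range g).indicator f x = ∑ y, f (g y) := by
    rw [← sum_image (f := f) (g := g) hg.injOn, ← sum_indicator_subset f (subset_univ _)]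
    simp
  cases isEmpty_or_nonempty Y
  · simp [avg_eq_sum_div]
  · rw [avg_eq_sum_div, avg_eq_sum_div, h, Nat.card_eq_fintype_card, Nat.card_eq_fintype_card]
    field_simp

lemma dens_le_one (A : Set X) : dens A ≤ 1 :=
  (avg_mono fun x ↦ Set.indicator_le_self' (fun _ _ ↦ zero_le_one) x).trans
    (avg_const_le zero_le_one)

lemma dens_sumElim {ι κ β : Type*} [Finite ι] [Finite κ] [Finite β] (A : Set (ι ⊕ κ → β)) :
    dens A = avg fun t : ι → β ↦ dens {w : κ → β | Sum.elim t w ∈ A} :=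
  avg_sumElim _

lemma inv_card_le_dens {A : Set X} (h : A.Nonempty) : (Nat.card X : ℝ)⁻¹ ≤ dens A := by
  obtain ⟨x, hx⟩ := h
  have : Nonempty X := ⟨x⟩
  have h1 := le_card_mul_avg (f := A.indicator 1)
    (fun x ↦ Set.indicator_nonneg (fun _ _ ↦ zero_le_one) x) x
  rw [Set.indicator_of_mem hx, Pi.one_apply] at h1
  have : (0 : ℝ) < Nat.card X := by exact_mod_cast Nat.card_pos
  rwa [inv_le_iff_one_le_mul₀' this]

lemma half_le_dens_of_le_avg {f : X → ℝ} (hf : ∀ x, f x ≤ 1) {δ : ℝ} (hδ : 0 ≤ δ)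
    (h : δ ≤ avg f) : δ / 2 ≤ dens {x | δ / 2 ≤ f x} := by
  have h1 : avg f ≤ avg fun x ↦ {x | δ / 2 ≤ f x}.indicator 1 x + δ / 2 := by
    refine avg_mono fun x ↦ ?_
    by_cases hx : δ / 2 ≤ f x
    · rw [Set.indicator_of_mem (s := {x | δ / 2 ≤ f x}) hx, Pi.one_apply]
      linarith [hf x]
    · rw [Set.indicator_of_notMem (s := {x | δ / 2 ≤ f x}) hx]
      linarith
  rw [avg_add] at h1
  have h2 : avg (fun _ : X ↦ δ / 2) ≤ δ / 2 := avg_const_le (by linarith)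
  rw [dens]
  linarith

lemma exists_le_dens_of_subset_iUnion {ι : Type*} [Finite ι] {A : Set X} {B : ι → Set X}
    (h : A ⊆ ⋃ i, B i) {δ : ℝ} (hδ : 0 < δ) (hA : δ ≤ dens A) :
    ∃ i, δ / (Nat.card ι + 1) ≤ dens (B i) := by
  have := Fintype.ofFinite ι
  by_contra! hB
  have h1 : dens A ≤ ∑ i, dens (B i) := by
    simp only [dens]
    rw [← avg_sum]
    refine avg_mono fun x ↦ ?_
    have h0 : ∀ i ∈ (univ : Finset ι), 0 ≤ (B i).indicator (1 : X → ℝ) x :=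
      fun i _ ↦ Set.indicator_nonneg (fun _ _ ↦ zero_le_one) x
    by_cases hx : x ∈ A
    · obtain ⟨i, hi⟩ := Set.mem_iUnion.1 (h hx)
      refine le_trans ?_ (single_le_sum h0 (mem_univ i))
      rw [Set.indicator_of_mem hx, Set.indicator_of_mem hi]
    · rw [Set.indicator_of_notMem hx]
      exact sum_nonneg h0
  have h2 : ∑ i, dens (B i) ≤ ∑ _i : ι, δ / (Nat.card ι + 1) := sum_le_sum fun i _ ↦ (hB i).le
  rw [sum_const, nsmul_eq_mul, card_univ, ← Nat.card_eq_fintype_card, mul_div_assoc'] at h2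
  have h3 : Nat.card ι * δ / (Nat.card ι + 1) < δ := by
    rw [div_lt_iff₀ (by positivity)]
    nlinarith
  linarith

end Average

/-- Every set of density at least `δ` in some cube over the alphabet `α` contains a line. -/
def LineDense (α : Type) (δ : ℝ) : Prop :=
  ∃ ι : Type, Finite ι ∧ ∀ A : Set (ι → α), δ ≤ dens A → ∃ l : Line α ι, ∀ x, l x ∈ A

section Subspaces

variable {α ι η : Type}

instance [Finite α] [Finite ι] : Finite (Line α ι) :=
  Finite.of_injective Line.idxFun fun _ _ ↦ Line.ext

/-- A subspace over `α`, evaluated at a word over `α` extended by an extra letter. -/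
def extend (V : Subspace η α ι) (w : η → Option α) (i : ι) : Option α :=
  (V.idxFun i).elim some w

lemma getD_extend (V : Subspace η α ι) (w : η → Option α) (a : α) (i : ι) :
    (extend V w i).getD a = V (fun e ↦ (w e).getD a) i := by
  cases h : V.idxFun i <;> simp [extend, Subspace.coe_apply, h]

/-- Composition of subspaces. -/
def comp {θ : Type} (V : Subspace η α ι) (U : Subspace θ α η) : Subspace θ α ι where
  idxFun i := (V.idxFun i).elim Sum.inl U.idxFun
  proper e := by
    obtain ⟨j, hj⟩ := U.proper e
    obtain ⟨i, hi⟩ := V.proper j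
    exact ⟨i, by simp [hi, hj]⟩

lemma comp_apply {θ : Type} (V : Subspace η α ι) (U : Subspace θ α η) (x : θ → α) :
    comp V U x = V (U x) := by
  ext i
  cases h : V.idxFun i <;> simp [comp, Subspace.coe_apply, h]

lemma subspace_injective (V : Subspace η α ι) : Function.Injective V := by
  intro x y h
  ext e
  obtain ⟨i, hi⟩ := V.proper e
  simpa [Subspace.coe_apply, hi] using congrFun h i

lemma exists_line (g : α → ι → α) (h : ∀ i, (∀ x, g x i = x) ∨ ∃ c, ∀ x, g x i = c)
    (h' : ∃ i, ∀ x, g x i = x) : ∃ l : Line α ι, ∀ x, l x = g x := by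
  classical
  refine ⟨⟨fun i ↦ if h1 : ∀ x, g x i = x then none else some ((h i).resolve_left h1).choose,
    h'.imp fun i hi ↦ dif_pos hi⟩, fun x ↦ ?_⟩
  ext i
  by_cases h1 : ∀ x, g x i = x
  · simp [h1]
  · simp only [Line.coe_apply, h1, dite_false, Option.getD_some]
    exact (((h i).resolve_left h1).choose_spec x).symm

/-- A set of words over `Option α` is insensitive to a letter `b` if changing occurrences of `b`
into the extra letter and vice versa does not affect membership. -/
def Insensitive (b : α) (E : Set (ι → Option α)) : Prop :=
  ∀ x y : ι → Option α,
    (∀ i, x i = y i ∨ (x i = none ∨ x i = some b) ∧ (y i = none ∨ y i = some b)) →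
    x ∈ E → y ∈ E

lemma Insensitive.compl {b : α} {E : Set (ι → Option α)} (hE : Insensitive b E) :
    Insensitive b Eᶜ := fun x y h hx hy ↦
  hx (hE y x (fun i ↦ (h i).imp Eq.symm And.symm) hy)

open Classical in
/-- The set of coordinates where a word does not have the extra letter. -/
noncomputable def letters [Fintype ι] (x : ι → Option α) : Finset ι := {i | x i ≠ none}

lemma mem_letters [Fintype ι] {x : ι → Option α} {i : ι} :
    i ∈ letters x ↔ x i ≠ none := by
  simp [letters]

end Subspaces

section FixedAlphabet

variable {α : Type} [Finite α]

lemma exists_line_dens_iInter (H : ∀ δ > 0, LineDense α δ) {δ : ℝ} (hδ : 0 < δ) :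
    ∃ ι : Type, Finite ι ∧ ∃ θ > 0, ∀ (Ω : Type) [Finite Ω] (A : (ι → α) → Set Ω),
      δ ≤ (avg fun y ↦ dens (A y)) → ∃ l : Line α ι, θ ≤ dens (⋂ a, A (l a)) := by
  obtain ⟨ι, hι, hH⟩ := H (δ / 2) (by linarith)
  refine ⟨ι, hι, δ / 2 / (Nat.card (Line α ι) + 1), by positivity, fun Ω _ A hA ↦ ?_⟩
  have h1 : (avg fun y ↦ dens (A y)) = avg fun ω ↦ dens {y | ω ∈ A y} := by
    simp only [dens]
    rw [avg_comm]
    rfl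
  rw [h1] at hA
  have h2 := half_le_dens_of_le_avg (fun ω ↦ dens_le_one _) hδ.le hA
  refine exists_le_dens_of_subset_iUnion (fun ω hω ↦ ?_) (by linarith) h2
  obtain ⟨l, hl⟩ := hH _ hω
  exact Set.mem_iUnion.2 ⟨l, Set.mem_iInter.2 hl⟩

lemma exists_subspace_fin (H : ∀ δ > 0, LineDense α δ) (d : ℕ) :
    ∀ δ > 0, ∃ ι : Type, Finite ι ∧ ∀ A : Set (ι → α), δ ≤ dens A →
      ∃ V : Subspace (Fin d) α ι, ∀ x, V x ∈ A := by
  induction d with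
  | zero =>
    refine fun δ hδ ↦ ⟨Unit, inferInstance, fun A hA ↦ ?_⟩
    obtain ⟨a, ha⟩ := nonempty_of_dens_pos (hδ.trans_le hA)
    exact ⟨⟨fun i ↦ Sum.inl (a i), fun e ↦ e.elim0⟩, fun x ↦ ha⟩
  | succ d ih =>
    intro δ hδ
    obtain ⟨ι, hι, θ, hθ, h1⟩ := exists_line_dens_iInter H hδ
    obtain ⟨κ, hκ, h2⟩ := ih θ hθ
    refine ⟨ι ⊕ κ, inferInstance, fun A hA ↦ ?_⟩
    rw [dens_sumElim] at hA
    obtain ⟨l, hl⟩ := h1 _ _ hA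
    obtain ⟨V, hV⟩ := h2 _ hl
    simp only [Set.mem_iInter, Set.mem_ofPred_eq] at hV
    refine ⟨⟨Sum.elim (fun i ↦ (l.idxFun i).elim (Sum.inr 0) Sum.inl)
      (fun i ↦ (V.idxFun i).map id Fin.succ), ?_⟩, fun x ↦ ?_⟩
    · refine Fin.cases ?_ fun e ↦ ?_
      · obtain ⟨i, hi⟩ := l.proper
        exact ⟨Sum.inl i, by simp [hi]⟩
      · obtain ⟨i, hi⟩ := V.proper e
        exact ⟨Sum.inr i, by simp [hi]⟩
    · convert hV (fun e ↦ x e.succ) (x 0)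
      ext (i | i)
      · cases h : l.idxFun i <;> simp [Subspace.coe_apply, h]
      · cases h : V.idxFun i <;> simp [Subspace.coe_apply, h]

lemma exists_subspace (H : ∀ δ > 0, LineDense α δ) (η : Type) [Finite η] {δ : ℝ} (hδ : 0 < δ) :
    ∃ ι : Type, Finite ι ∧ ∀ A : Set (ι → α), δ ≤ dens A →
      ∃ V : Subspace η α ι, ∀ x, V x ∈ A := by
  obtain ⟨n, ⟨e⟩⟩ := Finite.exists_equiv_fin η
  obtain ⟨ι, hι, h⟩ := exists_subspace_fin H n δ hδ
  refine ⟨ι, hι, fun A hA ↦ ?_⟩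
  obtain ⟨V, hV⟩ := h A hA
  refine ⟨V.reindex e.symm (Equiv.refl _) (Equiv.refl _), fun x ↦ ?_⟩
  convert hV (x ∘ e.symm)
  ext i
  simp [Subspace.reindex_apply]

lemma exists_dens_letters_lt (n : ℕ) {η : ℝ} (hη : 0 < η) [Nonempty α] :
    ∃ N : ℕ, dens {x : Fin N → Option α | #(letters x) < n} ≤ η := by
  have := Fintype.ofFinite α
  obtain ⟨k, hk_card⟩ : ∃ k : ℝ, k = Fintype.card α := ⟨_, rfl⟩
  have hk : 0 < k := by rw [hk_card]; exact_mod_cast Fintype.card_pos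
  have h1 : (1 + k / 2) / (1 + k) < 1 := by
    rw [div_lt_one (by positivity)]
    linarith
  obtain ⟨N, hN⟩ := exists_pow_lt_of_lt_one (show 0 < η / 2 ^ n by positivity) h1
  refine ⟨N, ?_⟩
  let u : Option α → ℝ := fun o ↦ o.elim 1 fun _ ↦ 1 / 2
  have hu : ∀ o, 0 ≤ u o := by rintro (_ | _) <;> simp [u]
  have h2 : ∀ x : Fin N → Option α, ∏ i, u (x i) = (1 / 2) ^ #(letters x) := by
    intro x
    rw [← prod_const, letters, prod_filter]
    refine prod_congr rfl fun i _ ↦ ?_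
    cases x i <;> simp [u]
  have h3 : avg (fun x : Fin N → Option α ↦ ∏ i, u (x i)) = ((1 + k / 2) / (1 + k)) ^ N := by
    rw [avg_eq_sum_div, ← Fintype.sum_pow, div_pow]
    simp [u, hk_card, Fintype.sum_option, add_comm, div_eq_mul_inv]
  calc _ ≤ avg fun x : Fin N → Option α ↦ 2 ^ n * ∏ i, u (x i) := by
        refine avg_mono fun x ↦ ?_
        by_cases hx : #(letters x) < n
        · rw [Set.indicator_of_mem (s := {x : Fin N → Option α | #(letters x) < n}) hx, h2,
            one_div, inv_pow, ← div_eq_mul_inv, Pi.one_apply, one_le_div (by positivity)]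
          exact pow_le_pow_right₀ (by norm_num) hx.le
        · rw [Set.indicator_of_notMem (s := {x : Fin N → Option α | #(letters x) < n}) hx]
          exact mul_nonneg (by positivity) (prod_nonneg fun i _ ↦ hu _)
    _ = 2 ^ n * ((1 + k / 2) / (1 + k)) ^ N := by rw [avg_const_mul, h3]
    _ ≤ 2 ^ n * (η / 2 ^ n) := by gcongr
    _ = η := by field_simp

end FixedAlphabet

section Insensitive

variable {α : Type} [Finite α]

lemma exists_subspace_of_insensitive [Nonempty α] (H : ∀ δ > 0, LineDense α δ) (b : α)
    (η : Type) [Finite η] {δ : ℝ} (hδ : 0 < δ) :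
    ∃ ι : Type, Finite ι ∧ ∀ E : Set (ι → Option α), Insensitive b E → δ ≤ dens E →
      ∃ V : Subspace η (Option α) ι, ∀ x, V x ∈ E := by
  classical
  obtain ⟨κ, hκ, hH⟩ := exists_subspace H η (show 0 < δ / 2 by linarith)
  have := Fintype.ofFinite κ
  obtain ⟨N, hN⟩ := exists_dens_letters_lt (α := α) (Fintype.card κ) (show 0 < δ / 3 by linarith)
  refine ⟨Fin N, inferInstance, fun E hE hd ↦ ?_⟩
  by_contra! hV
  have he : ∀ J : Finset (Fin N), Fintype.card κ ≤ #J →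
      ∃ e : κ → Fin N, e.Injective ∧ ∀ i, e i ∈ J := by
    intro J hJ
    rw [← Fintype.card_coe] at hJ
    obtain ⟨e⟩ := Function.Embedding.nonempty_of_card_le hJ
    exact ⟨fun i ↦ e i, fun i j h ↦ e.injective (Subtype.ext h), fun i ↦ (e i).2⟩
  choose e he_inj he_mem using he
  -- resample the letters on a copy of `κ` inside the set of coordinates with a letter
  let R (x : Fin N → Option α) (h : Fintype.card κ ≤ #(letters x)) (y : κ → α) :
      Fin N → Option α := Function.extend (e _ h) (fun j ↦ some (y j)) x
  have hR_letters : ∀ x h y, letters (R x h y) = letters x := by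
    intro x h y
    ext i
    by_cases hi : ∃ j, e _ h j = i
    · obtain ⟨j, rfl⟩ := hi
      have := mem_letters.1 (he_mem _ h j)
      rw [mem_letters, mem_letters]
      simp [R, (he_inj _ h).extend_apply, this]
    · rw [mem_letters, mem_letters]
      simp [R, Function.extend_apply' _ _ _ hi]
  let T (p : (Fin N → Option α) × (κ → α)) : (Fin N → Option α) × (κ → α) :=
    if h : Fintype.card κ ≤ #(letters p.1) then
      (R p.1 h p.2, fun j ↦ (p.1 (e _ h j)).getD b) else p
  have hT : Function.Involutive T := by
    rintro ⟨x, y⟩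
    by_cases h : Fintype.card κ ≤ #(letters x)
    · have h' : Fintype.card κ ≤ #(letters (R x h y)) := by rwa [hR_letters]
      have hee : e _ h' = e _ h := by congr 1; exact hR_letters x h y
      simp only [T, h, h', dite_true, Prod.mk.injEq]
      constructor
      · ext1 i
        by_cases hi : ∃ j, e _ h j = i
        · obtain ⟨j, rfl⟩ := hi
          obtain ⟨a, ha⟩ := Option.ne_none_iff_exists'.1 (mem_letters.1 (he_mem _ h j))
          simp only [R]
          simp only [R] at hee
          rw [hee, (he_inj _ h).extend_apply, ha]
          rfl
        · simp only [R]
          simp only [R] at hee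
          rw [hee, Function.extend_apply' _ _ _ hi, Function.extend_apply' _ _ _ hi]
      · ext1 j
        rw [hee]
        simp [R, (he_inj _ h).extend_apply]
    · simp [T, h]
  have h1 : dens E = avg fun x ↦ avg fun y ↦ E.indicator 1 (T (x, y)).1 := by
    have h := avg_equiv hT.toPerm fun p ↦ E.indicator (1 : (Fin N → Option α) → ℝ) p.1
    change avg (fun p ↦ E.indicator 1 (T p).1) = _ at h
    rw [← avg_prod (fun p ↦ E.indicator 1 (T p).1), h, avg_prod]
    simp only [avg_const]
    rfl
  have h2 : ∀ x, avg (fun y ↦ E.indicator (1 : (Fin N → Option α) → ℝ) (T (x, y)).1) ≤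
      {x : Fin N → Option α | #(letters x) < Fintype.card κ}.indicator 1 x + δ / 2 := by
    intro x
    by_cases h : Fintype.card κ ≤ #(letters x)
    · rw [Set.indicator_of_notMem (s := {x : Fin N → Option α | #(letters x) < Fintype.card κ})
        (not_lt.2 h), zero_add]
      by_contra! hx
      simp only [T, h, dite_true] at hx
      obtain ⟨V, hVE⟩ := hH {y | R x h y ∈ E} hx.le
      let V' : Subspace η (Option α) (Fin N) :=
        ⟨Function.extend (e _ h) (fun j ↦ (V.idxFun j).map some id) fun i ↦ Sum.inl (x i),
        fun t ↦ by
          obtain ⟨j, hj⟩ := V.proper t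
          exact ⟨e _ h j, by simp [(he_inj _ h).extend_apply, hj]⟩⟩
      obtain ⟨z, hz⟩ := hV V'
      refine hz (hE _ _ (fun i ↦ ?_) (hVE fun t ↦ (z t).getD b))
      by_cases hi : ∃ j, e _ h j = i
      · obtain ⟨j, rfl⟩ := hi
        cases hj : V.idxFun j with
        | inl a => simp [R, V', Subspace.coe_apply, (he_inj _ h).extend_apply, hj]
        | inr t =>
          cases hzt : z t <;>
            simp [R, V', Subspace.coe_apply, (he_inj _ h).extend_apply, hj, hzt]
      · simp [R, V', Subspace.coe_apply, Function.extend_apply' _ _ _ hi]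
    · rw [Set.indicator_of_mem (s := {x : Fin N → Option α | #(letters x) < Fintype.card κ})
        (not_le.1 h), Pi.one_apply]
      have : avg (fun y ↦ E.indicator (1 : (Fin N → Option α) → ℝ) (T (x, y)).1) ≤ 1 :=
        (avg_mono fun y ↦ Set.indicator_le_self' (fun _ _ ↦ zero_le_one) _).trans
          (avg_const_le zero_le_one)
      linarith
  have h3 := avg_mono h2
  rw [← h1, avg_add, avg_const] at h3
  change _ ≤ dens _ + _ at h3
  linarith

lemma avg_indicator_le_of_insensitive_aux [Nonempty α] (H : ∀ δ > 0, LineDense α δ) (b : α)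
    (η : Type) [Finite η] {ε : ℝ} (hε : 0 < ε) :
    ∃ c : ℝ, 0 < c ∧ c ≤ 1 ∧ ∀ q : ℕ, ∃ ι : Type, Finite ι ∧ ∀ E : Set (ι → Option α),
      Insensitive b E → ∀ f : (ι → Option α) → ℝ, (∀ x, f x ≤ 1) →
      (∀ V : Subspace η (Option α) ι, (avg fun z ↦ f (V z)) ≤ 0) →
      avg (E.indicator f) ≤ ε + (1 - c) ^ q * (dens E - ε) := by
  classical
  obtain ⟨κ, hκ, hH⟩ := exists_subspace_of_insensitive H b η hε
  have hcard : (1 : ℝ) ≤ Nat.card (κ → Option α) := by exact_mod_cast Nat.card_pos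
  refine ⟨(Nat.card (κ → Option α) : ℝ)⁻¹, by positivity, inv_le_one_of_one_le₀ hcard, ?_⟩
  set c := (Nat.card (κ → Option α) : ℝ)⁻¹ with hc
  have hc0 : 0 < c := by positivity
  have hc1 : c ≤ 1 := inv_le_one_of_one_le₀ hcard
  -- a choice of subspaces of dense insensitive sets
  obtain ⟨G, hG⟩ : ∃ G : Set (κ → Option α) → Set (κ → Option α), ∀ E, Insensitive b E →
      (G E = ∅ ∧ dens E ≤ ε) ∨
        ∃ V : Subspace η (Option α) κ, G E = Set.range V ∧ Set.range V ⊆ E := by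
    have : ∀ E : Set (κ → Option α), ∃ G : Set (κ → Option α), Insensitive b E →
        (G = ∅ ∧ dens E ≤ ε) ∨
          ∃ V : Subspace η (Option α) κ, G = Set.range V ∧ Set.range V ⊆ E := by
      intro E
      by_cases hE : Insensitive b E ∧ ε ≤ dens E
      · obtain ⟨V, hV⟩ := hH E hE.1 hE.2
        exact ⟨Set.range V, fun _ ↦ Or.inr ⟨V, rfl, Set.range_subset_iff.2 hV⟩⟩
      · exact ⟨∅, fun h ↦ Or.inl ⟨rfl, le_of_not_ge fun h' ↦ hE ⟨h, h'⟩⟩⟩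
    choose G hG using this
    exact ⟨G, hG⟩
  have hGsub : ∀ E, Insensitive b E → G E ⊆ E := by
    intro E hE
    rcases hG E hE with h | ⟨V, h, h'⟩
    · simp [h.1]
    · rwa [h]
  have hGdens : ∀ E, Insensitive b E → dens (E \ G E) - ε ≤ (1 - c) * (dens E - ε) := by
    intro E hE
    have h0 : dens (E \ G E) = dens E - dens (G E) := by
      rw [dens, dens, dens, ← avg_sub, Set.indicator_sdiff (hGsub E hE)]
      rfl
    rcases hG E hE with h | ⟨V, h, h'⟩
    · have : dens (G E) = 0 := by simp [h.1, dens, avg]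
      nlinarith [h.2]
    · have h1 : c ≤ dens (G E) := inv_card_le_dens (by rw [h]; exact Set.range_nonempty _)
      nlinarith [dens_le_one E]
  intro q
  induction q with
  | zero =>
    refine ⟨Unit, inferInstance, fun E _ f hf _ ↦ ?_⟩
    simp only [pow_zero, one_mul, add_sub_cancel]
    exact avg_mono fun x ↦ Set.indicator_le_indicator (hf x)
  | succ q ih =>
    obtain ⟨ι, hι, ih⟩ := ih
    refine ⟨κ ⊕ ι, inferInstance, fun E hE f hf hV ↦ ?_⟩
    let S (w : ι → Option α) : Set (κ → Option α) := {t | Sum.elim t w ∈ E}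
    have hS : ∀ w, Insensitive b (S w) := fun w x y h ↦ hE _ _ <| by
      rintro (i | i)
      · exact h i
      · exact Or.inl rfl
    have hSS : ∀ w w' : ι → Option α,
        (∀ i, w i = w' i ∨ (w i = none ∨ w i = some b) ∧ (w' i = none ∨ w' i = some b)) →
        S w = S w' := by
      intro w w' h
      ext t
      refine ⟨hE _ _ ?_, hE _ _ ?_⟩
      · rintro (i | i)
        · exact Or.inl rfl
        · exact h i
      · rintro (i | i)
        · exact Or.inl rfl
        · exact (h i).imp Eq.symm And.symm
    let E' (t : κ → Option α) : Set (ι → Option α) := {w | t ∈ S w \ G (S w)}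
    have hE' : ∀ t, Insensitive b (E' t) := by
      intro t w w' h hw
      simp only [E', Set.mem_ofPred_eq] at hw ⊢
      rwa [← hSS w w' h]
    have h1 : avg (E.indicator f) =
        (avg fun w ↦ avg ((G (S w)).indicator fun t ↦ f (Sum.elim t w))) +
        avg fun t ↦ avg ((E' t).indicator fun w ↦ f (Sum.elim t w)) := by
      rw [avg_sumElim, avg_comm (fun w t ↦ (G (S w)).indicator _ t), ← avg_add]
      congr 1
      ext t
      rw [← avg_add]
      congr 1
      ext w
      have := @hGsub (S w) (hS w) t
      by_cases h1 : t ∈ S w <;> by_cases h2 : t ∈ G (S w) <;>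
        simp_all [Set.indicator, E', S]
    have h2 : (avg fun w ↦ avg ((G (S w)).indicator fun t ↦ f (Sum.elim t w))) ≤ 0 := by
      refine (avg_mono fun w ↦ ?_).trans (avg_const_le le_rfl)
      rcases hG (S w) (hS w) with h | ⟨V, h, h'⟩
      · simp [h.1, avg]
      · rw [h, avg_indicator_range (subspace_injective V)]
        refine mul_nonpos_of_nonneg_of_nonpos (by positivity) ?_
        let V' : Subspace η (Option α) (κ ⊕ ι) :=
          ⟨Sum.elim V.idxFun fun i ↦ Sum.inl (w i), fun e ↦ by
            obtain ⟨i, hi⟩ := V.proper e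
            exact ⟨Sum.inl i, hi⟩⟩
        have hVV : ∀ z, Sum.elim (V z) w = V' z := by
          intro z
          ext1 (i | i) <;> simp [V', Subspace.coe_apply]
        simpa only [hVV] using hV V'
    have h3 : (avg fun t ↦ avg ((E' t).indicator fun w ↦ f (Sum.elim t w))) ≤
        avg fun t ↦ ε + (1 - c) ^ q * (dens (E' t) - ε) := by
      refine avg_mono fun t ↦ ih (E' t) (hE' t) _ (fun w ↦ hf _) fun V ↦ ?_
      let V' : Subspace η (Option α) (κ ⊕ ι) :=
        ⟨Sum.elim (fun i ↦ Sum.inl (t i)) V.idxFun, fun e ↦ by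
          obtain ⟨i, hi⟩ := V.proper e
          exact ⟨Sum.inr i, hi⟩⟩
      have hVV : ∀ z, Sum.elim t (V z) = V' z := by
        intro z
        ext1 (i | i) <;> simp [V', Subspace.coe_apply]
      simpa only [hVV] using hV V'
    have h4 : (avg fun t ↦ dens (E' t)) = avg fun w ↦ dens (S w \ G (S w)) := by
      simp only [dens]
      rw [avg_comm]
      rfl
    have h5 : (avg fun w ↦ dens (S w)) = dens E := by
      rw [dens_sumElim]
      simp only [dens]
      rw [avg_comm]
      rfl
    have h6 := avg_mono fun w ↦ hGdens (S w) (hS w)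
    rw [avg_sub, avg_const, avg_const_mul, avg_sub, avg_const, h5, ← h4] at h6
    rw [avg_add, avg_const, avg_const_mul, avg_sub, avg_const] at h3
    have h7 := mul_le_mul_of_nonneg_left h6 (pow_nonneg (sub_nonneg.2 hc1) q)
    rw [pow_succ, mul_assoc]
    linarith

lemma avg_indicator_le_of_insensitive [Nonempty α] (H : ∀ δ > 0, LineDense α δ) (b : α)
    (η : Type) [Finite η] {ε : ℝ} (hε : 0 < ε) :
    ∃ ι : Type, Finite ι ∧ ∀ E : Set (ι → Option α),
      Insensitive b E → ∀ f : (ι → Option α) → ℝ, (∀ x, f x ≤ 1) →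
      (∀ V : Subspace η (Option α) ι, (avg fun z ↦ f (V z)) ≤ 0) → avg (E.indicator f) ≤ ε := by
  obtain ⟨c, hc0, hc1, h⟩ :=
    avg_indicator_le_of_insensitive_aux H b η (show 0 < ε / 2 by linarith)
  obtain ⟨q, hq⟩ := exists_pow_lt_of_lt_one (show 0 < ε / 2 by linarith)
    (show 1 - c < 1 by linarith)
  obtain ⟨ι, hι, h⟩ := h q
  refine ⟨ι, hι, fun E hE f hf hV ↦ (h E hE f hf hV).trans ?_⟩
  have := pow_nonneg (sub_nonneg.2 hc1) q
  nlinarith [dens_le_one E]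

/-- If a function has nonpositive averages on all subspaces of a given dimension, then its integral
over any intersection of insensitive sets is small, in high dimension. -/
lemma avg_indicator_iInter_le [Nonempty α] (H : ∀ δ > 0, LineDense α δ) (η : Type) [Finite η]
    (s : Finset α) : ∀ ε > 0, ∃ ι : Type, Finite ι ∧ ∀ E : α → Set (ι → Option α),
      (∀ b ∈ s, Insensitive b (E b)) → ∀ f : (ι → Option α) → ℝ, (∀ x, f x ≤ 1) →
      (∀ V : Subspace η (Option α) ι, (avg fun z ↦ f (V z)) ≤ 0) →
      avg ((⋂ a ∈ s, E a).indicator f) ≤ ε := by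
  classical
  induction s using Finset.induction_on with
  | empty =>
    refine fun ε hε ↦ ⟨η, inferInstance, fun E _ f _ hV ↦ ?_⟩
    refine le_trans ?_ hε.le
    have h : (⋂ a ∈ (∅ : Finset α), E a) = Set.univ := by simp
    rw [h, Set.indicator_univ]
    exact hV default
  | insert b s _ ih =>
    intro ε hε
    obtain ⟨κ, hκ, h1⟩ := ih (ε / 2) (by linarith)
    obtain ⟨ι, hι, h2⟩ := avg_indicator_le_of_insensitive H b κ (show 0 < ε / 2 by linarith)
    refine ⟨ι, hι, fun E hE f hf hV ↦ ?_⟩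
    have h3 := h2 (E b) (hE b (mem_insert_self b s))
      (fun x ↦ (⋂ a ∈ s, E a).indicator f x - ε / 2)
      (fun x ↦ by
        have : (⋂ a ∈ s, E a).indicator f x ≤ 1 :=
          Set.indicator_apply_le' (fun _ ↦ hf x) fun _ ↦ zero_le_one
        linarith)
      (fun V ↦ by
        rw [avg_sub, avg_const, sub_nonpos]
        convert h1 (fun b ↦ V ⁻¹' E b) (fun a ha x y h ↦ hE a (mem_insert_of_mem ha) _ _ fun i ↦ ?_)
          (fun z ↦ f (V z)) (fun z ↦ hf _) (fun U ↦ ?_) using 2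
        · ext z
          simp [Set.indicator]
        · cases hi : V.idxFun i with
          | inl c => simp [Subspace.coe_apply, hi]
          | inr j => simpa [Subspace.coe_apply, hi] using h j
        · simpa only [comp_apply] using hV (comp V U))
    have h4 : avg ((⋂ a ∈ insert b s, E a).indicator f) ≤
        avg fun x ↦ (E b).indicator (fun x ↦ (⋂ a ∈ s, E a).indicator f x - ε / 2) x + ε / 2 := by
      refine avg_mono fun x ↦ ?_
      by_cases hb : x ∈ E b
      · by_cases hs : x ∈ ⋂ b ∈ s, E b <;> simp_all [Set.indicator]
      · simp [Set.indicator, hb]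
        linarith
    rw [avg_add, avg_const] at h4
    linarith

end Insensitive

/-- A Ramsey theorem for words over `Option α`: inside a suitable subspace over `α`, the colour of
a word with an occurrence of the extra letter only depends on the part up to this occurrence. -/
lemma exists_subspace_color_eq (α : Type) [Finite α] (N : ℕ) :
    ∀ (κ : Type) [Finite κ], ∃ ι : Type, Finite ι ∧ ∀ color : (ι → Option α) → κ,
      ∃ V : Subspace (Fin N) α ι, ∀ j w w', (∀ i ≤ j, w i = w' i) → w j = none →
        color (extend V w) = color (extend V w') := by
  induction N with
  | zero =>
    intro κ _
    exact ⟨Empty, inferInstance, fun _ ↦ ⟨⟨fun i ↦ i.elim, fun e ↦ e.elim0⟩, fun j ↦ j.elim0⟩⟩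
  | succ N ih =>
    intro κ _
    obtain ⟨η, hη, ih⟩ := ih (α → κ)
    obtain ⟨s, _, hs⟩ := Subspace.exists_mono_in_high_dimension (Option α) κ η
    refine ⟨Option s, inferInstance, fun color ↦ ?_⟩
    obtain ⟨V₁, c, hV₁⟩ := hs fun z ↦ color fun o ↦ o.elim none z
    let fill (a : α) (z : η → Option α) (o : Option s) : Option α :=
      o.elim (some a) fun i ↦ (V₁.idxFun i).elim (fun b ↦ some (b.getD a)) z
    obtain ⟨V₂, hV₂⟩ := ih fun z a ↦ color (fill a z)
    let V : Subspace (Fin (N + 1)) α (Option s) :=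
      ⟨fun o ↦ o.elim (Sum.inr 0) fun i ↦ (V₁.idxFun i).elim (fun b ↦ b.elim (Sum.inr 0) Sum.inl)
        fun e ↦ (V₂.idxFun e).map id Fin.succ, by
        refine Fin.cases ⟨none, rfl⟩ fun j ↦ ?_
        obtain ⟨e, he⟩ := V₂.proper j
        obtain ⟨i, hi⟩ := V₁.proper e
        exact ⟨some i, by simp [hi, he]⟩⟩
    have h1 : ∀ w, w 0 = none →
        extend V w = fun o ↦ o.elim none (V₁ (extend V₂ fun j ↦ w j.succ)) := by
      intro w hw
      ext1 (_ | i)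
      · simpa [V, extend]
      · rcases h : V₁.idxFun i with (_ | b) | e
        · simpa [V, extend, h, Subspace.coe_apply]
        · simp [V, extend, h, Subspace.coe_apply]
        · cases h' : V₂.idxFun e <;> simp [V, extend, h, h', Subspace.coe_apply]
    have h2 : ∀ w a, w 0 = some a → extend V w = fill a (extend V₂ fun j ↦ w j.succ) := by
      intro w a hw
      ext1 (_ | i)
      · simpa [V, extend, fill]
      · rcases h : V₁.idxFun i with (_ | b) | e
        · simpa [V, extend, h, fill]
        · simp [V, extend, h, fill]
        · cases h' : V₂.idxFun e <;> simp [V, extend, h, h', fill]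
    refine ⟨V, fun j w w' hw hj ↦ ?_⟩
    have h0 := hw 0 (Fin.zero_le j)
    cases h : w 0 with
    | none => exact h1 w h ▸ h1 w' (h0 ▸ h) ▸ (hV₁ _).trans (hV₁ _).symm
    | some a =>
      rw [h2 w a h, h2 w' a (h0 ▸ h)]
      revert hw hj
      refine Fin.cases (fun _ hj ↦ by simp [hj] at h) (fun j hw hj ↦ ?_) j
      exact congrFun (hV₂ j _ _ (fun i hi ↦ hw _ (Fin.succ_le_succ_iff.2 hi)) hj) a

lemma exists_subspace_dens_iInter {α : Type} [Finite α] [Nonempty α] (H : ∀ δ > 0, LineDense α δ)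
    {δ : ℝ} (hδ : 0 < δ) :
    ∃ θ > 0, ∀ (m : Type) [Finite m], ∃ ι : Type, Finite ι ∧
      ∀ (Ω : Type) [Finite Ω] (A : (ι → Option α) → Set Ω), (∀ y, δ ≤ dens (A y)) →
        ∃ W : Subspace (Option m) α ι, ∀ z : m → Option α, θ ≤ dens (⋂ a : α,
          A fun i ↦ some (W (fun o ↦ o.elim a fun e ↦ (z e).getD a) i)) := by
  obtain ⟨m₀, hm₀, θ, hθ, hH⟩ := exists_line_dens_iInter H hδ
  refine ⟨θ, hθ, fun m _ ↦ ?_⟩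
  obtain ⟨M₀, ⟨e₀⟩⟩ := Finite.exists_equiv_fin m₀
  obtain ⟨M, ⟨e₁⟩⟩ := Finite.exists_equiv_fin m
  obtain ⟨ι, hι, hQ⟩ := exists_subspace_color_eq α (M₀ + M) Prop
  refine ⟨ι, hι, fun Ω _ A hA ↦ ?_⟩
  let color (w : ι → Option α) : Prop := θ ≤ dens (⋂ a, A fun i ↦ some ((w i).getD a))
  obtain ⟨V, hV⟩ := hQ color
  let mk {β : Type} (x : m₀ → β) (y : m → β) : Fin (M₀ + M) → β :=
    Fin.append (x ∘ e₀.symm) (y ∘ e₁.symm)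
  obtain ⟨c⟩ := ‹Nonempty α›
  obtain ⟨l, hl⟩ := hH Ω (fun y ↦ A fun i ↦ some (V (mk y fun _ ↦ c) i)) (by
    rw [← avg_const (X := m₀ → α) δ]
    exact avg_mono fun y ↦ hA _)
  have h0 : color (extend V (mk l.idxFun fun _ ↦ some c)) := by
    have h : ∀ a, (fun i ↦ (mk l.idxFun (fun _ ↦ some c) i).getD a) = mk (l a) fun _ ↦ c := by
      intro a
      ext i
      refine Fin.addCases (fun i ↦ ?_) (fun i ↦ ?_) i <;> simp [mk, Line.coe_apply]
    simpa only [color, getD_extend, h] using hl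
  obtain ⟨j, hj⟩ := l.proper
  have h1 : ∀ z : m → Option α, color (extend V (mk l.idxFun z)) := by
    intro z
    rw [← hV (Fin.castAdd M (e₀ j)) _ _ ?_ ?_]
    · exact h0
    · refine fun i ↦ Fin.addCases (fun i _ ↦ by simp [mk]) (fun i hi ↦ ?_) i
      exact absurd hi (by simp [Fin.le_def]; omega)
    · simp [mk, hj]
  let U : Subspace (Option m) α (Fin (M₀ + M)) :=
    ⟨mk (fun i ↦ (l.idxFun i).elim (Sum.inr none) Sum.inl) fun i ↦ Sum.inr (some i), by
      rintro (_ | i)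
      · exact ⟨Fin.castAdd M (e₀ j), by simp [mk, hj]⟩
      · exact ⟨Fin.natAdd M₀ (e₁ i), by simp [mk]⟩⟩
  refine ⟨comp V U, fun z ↦ ?_⟩
  have h : ∀ a, (fun i ↦ (mk l.idxFun z i).getD a) =
      U fun o ↦ o.elim a fun e ↦ (z e).getD a := by
    intro a
    ext i
    refine Fin.addCases (fun i ↦ ?_) (fun i ↦ ?_) i
    · cases h : l.idxFun (e₀.symm i) <;> simp [mk, U, h, Subspace.coe_apply]
    · simp [mk, U, Subspace.coe_apply]
  simpa only [color, getD_extend, h, ← comp_apply] using h1 z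

lemma avg_le_of_avg_indicator_le {α Z : Type} [Fintype α] [Finite Z] (C : α → Set Z) (f : Z → ℝ)
    {η c : ℝ} (hη : 0 ≤ η) (hf : ∀ z ∈ ⋂ a, C a, f z = -c)
    (h : ∀ σ : Set α, avg ((⋂ a, {z | z ∈ C a ↔ a ∈ σ}).indicator f) ≤ η) :
    avg f ≤ Nat.card (Set α) * η - c * dens (⋂ a, C a) := by
  classical
  let E (σ : Set α) : Set Z := ⋂ a, {z | z ∈ C a ↔ a ∈ σ}
  have h1 : avg f = ∑ σ, avg ((E σ).indicator f) := by
    rw [← avg_sum]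
    congr 1
    ext z
    rw [Finset.sum_eq_single {a | z ∈ C a}]
    · rw [Set.indicator_of_mem]
      simp [E]
    · intro σ _ hσ
      refine Set.indicator_of_notMem (fun hz ↦ hσ ?_) _
      ext a
      exact (Set.mem_iInter.1 hz a).symm
    · simp
  have hE : E Set.univ = ⋂ a, C a := by simp [E]
  have h2 : avg ((E Set.univ).indicator f) = -c * dens (⋂ a, C a) := by
    rw [hE, dens, ← avg_const_mul]
    congr 1
    ext z
    by_cases hz : z ∈ ⋂ a, C a
    · rw [Set.indicator_of_mem hz, Set.indicator_of_mem hz, hf z hz, Pi.one_apply, mul_one]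
    · rw [Set.indicator_of_notMem hz, Set.indicator_of_notMem hz, mul_zero]
  have h3 : ∀ σ, avg ((E σ).indicator f) ≤
      η + if σ = Set.univ then -c * dens (⋂ a, C a) else 0 := by
    intro σ
    split_ifs with hσ
    · rw [hσ, h2]
      linarith
    · rw [add_zero]
      exact h σ
  rw [h1]
  refine (sum_le_sum fun σ _ ↦ h3 σ).trans ?_
  rw [sum_add_distrib, sum_ite_eq' univ, if_pos (mem_univ _), sum_const, card_univ,
    Nat.card_eq_fintype_card, nsmul_eq_mul]
  linarith

section LineFree

variable {α p m N : Type} {A : Set (p ⊕ N → Option α)}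
  (hA : ∀ l : Line (Option α) (p ⊕ N), ∃ x, l x ∉ A)
include hA

lemma dens_lt_of_line_free {δ : ℝ}
    (hN : ∀ A : Set (N → Option α), δ ≤ dens A → ∃ l : Line (Option α) N, ∀ x, l x ∈ A)
    (y : p → Option α) : dens {ω | Sum.elim y ω ∈ A} < δ := by
  by_contra! h
  obtain ⟨l, hl⟩ := hN _ h
  obtain ⟨l', hl'⟩ := exists_line (fun x ↦ Sum.elim y (l x))
    (by
      rintro (i | i)
      · exact Or.inr ⟨_, fun x ↦ rfl⟩
      · cases h : l.idxFun i with
        | none => exact Or.inl fun x ↦ by simp [Line.coe_apply, h]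
        | some c => exact Or.inr ⟨c, fun x ↦ by simp [Line.coe_apply, h]⟩)
    (by
      obtain ⟨i, hi⟩ := l.proper
      exact ⟨Sum.inr i, fun x ↦ by simp [Line.coe_apply, hi]⟩)
  obtain ⟨x, hx⟩ := hA l'
  exact hx (hl' x ▸ hl x)

lemma dens_subspace_lt_of_line_free {δ : ℝ} {κ : Type}
    (hκ : ∀ A : Set (κ → Option α), δ ≤ dens A → ∃ l : Line (Option α) κ, ∀ x, l x ∈ A)
    (W : Subspace (Option m) α p) (V : Subspace κ (Option α) m) (ω : N → Option α) :
    dens {u | Sum.elim (extend W fun o ↦ o.elim none (V u)) ω ∈ A} < δ := by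
  by_contra! h
  obtain ⟨l, hl⟩ := hκ _ h
  obtain ⟨l', hl'⟩ := exists_line
    (fun x ↦ Sum.elim (extend W fun o ↦ o.elim none (V (l x))) ω)
    (by
      rintro (i | i)
      · rcases h : W.idxFun i with c | _ | e
        · exact Or.inr ⟨some c, fun x ↦ by simp [extend, h]⟩
        · exact Or.inr ⟨none, fun x ↦ by simp [extend, h]⟩
        · rcases h' : V.idxFun e with c | j
          · exact Or.inr ⟨c, fun x ↦ by simp [extend, h, Subspace.coe_apply, h']⟩
          · cases h'' : l.idxFun j with
            | none =>
              exact Or.inl fun x ↦ by simp [extend, h, Subspace.coe_apply, h', Line.coe_apply, h'']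
            | some c =>
              exact Or.inr ⟨c, fun x ↦ by
                simp [extend, h, Subspace.coe_apply, h', Line.coe_apply, h'']⟩
      · exact Or.inr ⟨_, fun x ↦ rfl⟩)
    (by
      obtain ⟨j, hj⟩ := l.proper
      obtain ⟨e, he⟩ := V.proper j
      obtain ⟨i, hi⟩ := W.proper (some e)
      exact ⟨Sum.inl i, fun x ↦ by
        simp [extend, hi, Subspace.coe_apply, he, Line.coe_apply, hj]⟩)
  obtain ⟨x, hx⟩ := hA l'
  exact hx (hl' x ▸ hl x)

lemma notMem_of_line_free (W : Subspace (Option m) α p) (ω : N → Option α) (z : m → Option α)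
    (hz : ∀ a : α, Sum.elim
      (fun i ↦ some (W (fun o ↦ o.elim a fun e ↦ (z e).getD a) i)) ω ∈ A) :
    Sum.elim (extend W fun o ↦ o.elim none z) ω ∉ A := by
  intro h
  obtain ⟨l', hl'⟩ := exists_line
    (fun x : Option α ↦ Sum.elim (x.elim (extend W fun o ↦ o.elim none z)
      fun a i ↦ some (W (fun o ↦ o.elim a fun e ↦ (z e).getD a) i)) ω)
    (by
      rintro (i | i)
      · rcases h : W.idxFun i with c | _ | e
        · exact Or.inr ⟨some c, by rintro (_ | a) <;> simp [extend, Subspace.coe_apply, h]⟩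
        · exact Or.inl (by rintro (_ | a) <;> simp [extend, Subspace.coe_apply, h])
        · cases h' : z e with
          | none => exact Or.inl (by rintro (_ | a) <;> simp [extend, Subspace.coe_apply, h, h'])
          | some c =>
            exact Or.inr ⟨c, by rintro (_ | a) <;> simp [extend, Subspace.coe_apply, h, h']⟩
      · exact Or.inr ⟨_, fun x ↦ rfl⟩)
    (by
      obtain ⟨i, hi⟩ := W.proper none
      exact ⟨Sum.inl i, by rintro (_ | a) <;> simp [extend, Subspace.coe_apply, hi]⟩)
  obtain ⟨_ | a, hx⟩ := hA l'
  · exact hx (hl' none ▸ h)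
  · exact hx (hl' (some a) ▸ hz a)

end LineFree

lemma lineDense_option_sub {α : Type} [Finite α] [Nonempty α] (H : ∀ δ > 0, LineDense α δ)
    {δ : ℝ} (hδ : 0 < δ) (hδ' : ∀ ε > 0, LineDense (Option α) (δ + ε)) :
    ∃ ε > 0, LineDense (Option α) (δ - ε) := by
  have := Fintype.ofFinite α
  obtain ⟨θ, hθ, h1⟩ := exists_subspace_dens_iInter H (half_pos hδ)
  have hK : (0 : ℝ) < Nat.card (Set α) := by exact_mod_cast Nat.card_pos
  obtain ⟨K, hK'⟩ : ∃ K : ℝ, K = Nat.card (Set α) := ⟨_, rfl⟩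
  rw [← hK'] at hK
  obtain ⟨κ, hκ, h2⟩ := hδ' (δ * θ / 8) (by positivity)
  obtain ⟨m, hm, h3⟩ := avg_indicator_iInter_le H κ univ (δ * θ / (8 * K)) (by positivity)
  obtain ⟨p, hp, h1⟩ := h1 m
  obtain ⟨P, hP'⟩ : ∃ P : ℝ, P = Nat.card (p → Option α) := ⟨_, rfl⟩
  have hP : 0 < P := by rw [hP']; exact_mod_cast Nat.card_pos
  obtain ⟨ε, hε, hε1, hε2⟩ : ∃ ε : ℝ, 0 < ε ∧ P * (2 * ε) ≤ δ / 2 ∧ P * (2 * ε) ≤ δ * θ / 8 := by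
    refine ⟨min (δ / 2) (δ * θ / 8) / P / 2, by positivity, ?_, ?_⟩
    · rw [mul_div_cancel₀ _ two_ne_zero, mul_div_cancel₀ _ hP.ne']
      exact min_le_left _ _
    · rw [mul_div_cancel₀ _ two_ne_zero, mul_div_cancel₀ _ hP.ne']
      exact min_le_right _ _
  obtain ⟨N, hN, h4⟩ := hδ' ε hε
  refine ⟨ε, hε, p ⊕ N, inferInstance, fun A hd ↦ ?_⟩
  by_contra! hA
  have h5 : ∀ y : p → Option α, δ - P * (2 * ε) ≤ dens {ω | Sum.elim y ω ∈ A} := by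
    intro y
    have h := le_card_mul_avg (f := fun y : p → Option α ↦ δ + ε - dens {ω | Sum.elim y ω ∈ A})
      (fun y ↦ sub_nonneg.2 (dens_lt_of_line_free hA h4 y).le) y
    rw [avg_sub, avg_const, ← dens_sumElim, ← hP'] at h
    nlinarith
  obtain ⟨W, hW⟩ := h1 _ (fun y ↦ {ω | Sum.elim y ω ∈ A}) fun y ↦ by linarith [h5 y]
  let F (ω : N → Option α) : Set (m → Option α) :=
    {z | Sum.elim (extend W fun o ↦ o.elim none z) ω ∈ A}
  let C (ω : N → Option α) (a : α) : Set (m → Option α) :=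
    {z | Sum.elim (fun i ↦ some (W (fun o ↦ o.elim a fun e ↦ (z e).getD a) i)) ω ∈ A}
  have hC : ∀ ω a, Insensitive a (C ω a) := by
    intro ω a x y h hx
    have : (fun e ↦ (y e).getD a) = fun e ↦ (x e).getD a := by
      ext e
      rcases h e with h | ⟨h | h, h' | h'⟩ <;> simp [*]
    simpa only [C, Set.mem_ofPred_eq, congrFun this] using hx
  have h6 : ∀ ω, dens (F ω) - (δ + δ * θ / 8) ≤
      K * (δ * θ / (8 * K)) - (δ + δ * θ / 8) * dens (⋂ a, C ω a) := by
    intro ω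
    have h := avg_le_of_avg_indicator_le (C ω)
      (fun z ↦ (F ω).indicator 1 z - (δ + δ * θ / 8)) (η := δ * θ / (8 * K))
      (c := δ + δ * θ / 8) (by positivity) ?_ ?_
    · rwa [avg_sub, avg_const, ← hK'] at h
    · intro z hz
      rw [Set.indicator_of_notMem, zero_sub]
      exact notMem_of_line_free hA W ω z (Set.mem_iInter.1 hz)
    · intro σ
      have h := h3 (fun a ↦ {z | z ∈ C ω a ↔ a ∈ σ}) ?_
        (fun z ↦ (F ω).indicator 1 z - (δ + δ * θ / 8)) ?_ ?_
      · simpa using h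
      · intro a _
        by_cases ha : a ∈ σ
        · simpa [ha] using hC ω a
        · simpa only [ha, iff_false] using! (hC ω a).compl
      · intro z
        have : (F ω).indicator (1 : (m → Option α) → ℝ) z ≤ 1 :=
          Set.indicator_le_self' (fun _ _ ↦ zero_le_one) _
        have : 0 < δ + δ * θ / 8 := by positivity
        linarith
      · intro V
        rw [avg_sub, avg_const, sub_nonpos]
        exact (dens_subspace_lt_of_line_free hA h2 W V ω).le
  have h7 := avg_mono h6
  rw [avg_sub, avg_sub, avg_const, avg_const, avg_const_mul, mul_div_assoc', mul_comm (8 : ℝ),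
    mul_div_mul_left _ _ hK.ne'] at h7
  have h8 : δ - P * (2 * ε) ≤ avg fun ω ↦ dens (F ω) := by
    simp only [dens]
    rw [avg_comm, ← avg_const (X := m → Option α) (δ - P * (2 * ε))]
    exact avg_mono fun z ↦ h5 _
  have h9 : θ ≤ avg fun ω ↦ dens (⋂ a, C ω a) := by
    simp only [dens]
    rw [avg_comm, ← avg_const (X := m → Option α) θ]
    refine avg_mono fun z ↦ (hW z).trans (le_of_eq ?_)
    simp only [dens]
    congr 1
    ext ω
    refine Set.indicator_eq_indicator (Iff.trans Set.mem_iInter ?_) rfl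
    exact (Set.mem_iInter (s := C ω)).symm
  have h10 : (δ + δ * θ / 8) * θ ≤ (δ + δ * θ / 8) * avg fun ω ↦ dens (⋂ a, C ω a) := by gcongr
  nlinarith [mul_pos hδ hθ, mul_pos (mul_pos hδ hθ) hθ]

lemma LineDense.mono {α : Type} {δ δ' : ℝ} (h : LineDense α δ) (hδ : δ ≤ δ') : LineDense α δ' :=
  let ⟨ι, hι, h⟩ := h
  ⟨ι, hι, fun A hA ↦ h A (hδ.trans hA)⟩

/-- The density Hales-Jewett theorem. -/
theorem lineDense (α : Type) [Finite α] : ∀ δ > 0, LineDense α δ := by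
  induction α using Finite.induction_empty_option with
  | of_equiv e ih =>
    intro δ hδ
    obtain ⟨ι, hι, h⟩ := ih δ hδ
    refine ⟨ι, hι, fun A hA ↦ ?_⟩
    obtain ⟨l, hl⟩ := h {x | e ∘ x ∈ A} (by
      refine hA.trans (le_of_eq ?_)
      rw [dens, dens, ← avg_equiv (Equiv.arrowCongr (Equiv.refl ι) e)]
      rfl)
    refine ⟨l.map e, fun x ↦ ?_⟩
    obtain ⟨x, rfl⟩ := e.surjective x
    rw [Line.map_apply]
    exact hl x
  | h_empty => exact fun δ _ ↦ ⟨Unit, inferInstance, fun A _ ↦ ⟨default, fun x ↦ x.elim⟩⟩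
  | @h_option α _ ih =>
    intro δ₀ hδ₀
    cases isEmpty_or_nonempty α
    · refine ⟨Unit, inferInstance, fun A hA ↦ ⟨default, fun x ↦ ?_⟩⟩
      obtain ⟨a, ha⟩ := nonempty_of_dens_pos (hδ₀.trans_le hA)
      rw [Subsingleton.elim a ((default : Line (Option α) Unit) x)] at ha
      exact ha
    by_contra h
    have h1 : ∀ δ, LineDense (Option α) δ → δ₀ ≤ δ := fun δ hδ ↦
      le_of_not_ge fun h' ↦ h (hδ.mono h')
    have h2 : LineDense (Option α) 2 := ⟨Unit, inferInstance, fun A hA ↦ by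
      linarith [dens_le_one A]⟩
    have h3 : δ₀ ≤ sInf {δ | LineDense (Option α) δ} := le_csInf ⟨2, h2⟩ h1
    obtain ⟨ε, hε, h4⟩ := lineDense_option_sub ih (hδ₀.trans_le h3) fun ε hε ↦ by
      obtain ⟨δ, hδ, hδ'⟩ := exists_lt_of_csInf_lt ⟨2, h2⟩
        (lt_add_of_pos_right (sInf {δ | LineDense (Option α) δ}) hε)
      exact hδ.mono hδ'.le
    linarith [csInf_le (s := {δ | LineDense (Option α) δ}) ⟨δ₀, h1⟩ h4]

lemma exists_le_of_le_avg {X : Type*} [Finite X] [Nonempty X] {f : X → ℝ} {c : ℝ}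
    (h : c ≤ avg f) : ∃ x, c ≤ f x := by
  have := Fintype.ofFinite X
  by_contra! h'
  refine h.not_gt ?_
  rw [avg_eq_sum_div, div_lt_iff₀ (by positivity), mul_comm]
  simpa using sum_lt_sum_of_nonempty univ_nonempty fun x _ ↦ h' x

lemma sum_line_apply {G ι : Type*} [AddCommGroup G] [Fintype ι] {X : Set G} (l : Line X ι) :
    ∃ (a : G) (d : ℤ), 0 < d ∧ ∀ x, ∑ i, (l x i : G) = a + d • (x : G) := by
  classical
  refine ⟨∑ i, (l.idxFun i).elim 0 fun x ↦ (x : G), #{i | l.idxFun i = none}, ?_, fun x ↦ ?_⟩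
  · obtain ⟨i, hi⟩ := l.proper
    exact_mod_cast card_pos.2 ⟨i, by simpa using hi⟩
  · rw [natCast_zsmul, ← sum_const, sum_filter, ← sum_add_distrib]
    refine sum_congr rfl fun i _ ↦ ?_
    cases h : l.idxFun i <;> simp [Line.coe_apply, h]

lemma exists_add_mem_grid {r N M : ℕ} (hM : 2 * M < N) {δ : ℝ} (hδ : 0 < δ)
    {A : Finset (Fin r → ℤ)} (hA : ∀ p ∈ A, ∀ i, 1 ≤ p i ∧ p i ≤ (N : ℤ))
    (hc : δ * (N : ℝ) ^ r ≤ #A) {W : Type*} [Finite W] [Nonempty W] (φ : W → Fin r → ℤ)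
    (hφ : ∀ w i, |φ w i| ≤ M) : ∃ s, δ / 2 ^ r ≤ dens {w | s + φ w ∈ A} := by
  classical
  let B : Finset (Fin r → ℤ) := Fintype.piFinset fun _ ↦ Icc (1 - M : ℤ) (N + M)
  have hB : (#B : ℝ) ≤ (2 * N) ^ r := by
    have : #B = (N + 2 * M) ^ r := by
      simp only [B, Fintype.card_piFinset, Int.card_Icc, prod_const, card_univ, Fintype.card_fin]
      congr 1
      omega
    rw [this]
    exact_mod_cast Nat.pow_le_pow_left (by omega) r
  have hB0 : B.Nonempty := ⟨fun _ ↦ 1, by simp [B, Fintype.mem_piFinset]; omega⟩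
  have := hB0.to_subtype
  have hN : (0 : ℝ) < N := by exact_mod_cast (by omega : 0 < N)
  suffices h : δ / 2 ^ r ≤ avg fun s : B ↦ dens {w | s + φ w ∈ A} from
    let ⟨s, hs⟩ := exists_le_of_le_avg h
    ⟨s, hs⟩
  simp only [dens]
  rw [avg_comm, ← avg_const (X := W) (δ / 2 ^ r)]
  refine avg_mono fun w ↦ ?_
  rw [avg_eq_sum_div, Fintype.card_coe, le_div_iff₀ (by exact_mod_cast hB0.card_pos)]
  calc δ / 2 ^ r * #B ≤ δ / 2 ^ r * (2 * N) ^ r := by gcongr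
    _ = δ * N ^ r := by rw [mul_pow]; field_simp
    _ ≤ #A := hc
    _ ≤ #{s ∈ B | s + φ w ∈ A} := by
      rw [← card_image_of_injective A (sub_left_injective (b := φ w))]
      gcongr
      intro s hs
      obtain ⟨p, hp, rfl⟩ := mem_image.1 hs
      refine mem_filter.2 ⟨Fintype.mem_piFinset.2 fun i ↦ mem_Icc.2 ?_, by simpa⟩
      have := abs_le.1 (hφ w i)
      have := hA p hp i
      simp only [Pi.sub_apply]
      omega
    _ = ∑ s : B, Set.indicator {w | s + φ w ∈ A} 1 w := by
      rw [sum_coe_sort B fun s ↦ Set.indicator {w | s + φ w ∈ A} (1 : W → ℝ) w, card_filter]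
      push_cast
      exact sum_congr rfl fun s _ ↦ by simp [Set.indicator]

end DensityHalesJewett

/-- **The multidimensional Szemerédi theorem** (Furstenberg–Katznelson; Theorem 10.3).
For every `δ > 0`, every positive integer `r` and every finite subset `X ⊆ ℤ^r` there is a
positive integer `N` such that every subset `A` of the grid `{1,…,N}^r` of size at least
`δ·N^r` contains a subset of the form `a + d • X` for some `a ∈ ℤ^r` and positive integer `d`. -/
theorem multidimensional_szemeredi (δ : ℝ) (hδ : 0 < δ) (r : ℕ) (hr : 0 < r)
    (X : Finset (Fin r → ℤ)) :
    ∃ N : ℕ, 0 < N ∧ ∀ A : Finset (Fin r → ℤ),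
      (∀ p ∈ A, ∀ i, 1 ≤ p i ∧ p i ≤ (N : ℤ)) →
      δ * (N : ℝ) ^ r ≤ (A.card : ℝ) →
      ∃ (a : Fin r → ℤ) (d : ℤ), 0 < d ∧ ∀ x ∈ X, a + d • x ∈ A := by
  rcases X.eq_empty_or_nonempty with rfl | hX
  · exact ⟨1, one_pos, fun _ _ _ ↦ ⟨0, 1, one_pos, by simp⟩⟩
  have := hX.to_subtype
  obtain ⟨ι, hι, h⟩ := DensityHalesJewett.lineDense (X : Set (Fin r → ℤ)) (δ / 2 ^ r)
    (by positivity)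
  have := Fintype.ofFinite ι
  let φ (w : ι → (X : Set (Fin r → ℤ))) : Fin r → ℤ := ∑ i, (w i : Fin r → ℤ)
  obtain ⟨M, hM⟩ : ∃ M : ℕ, ∀ w i, |φ w i| ≤ M := by
    obtain ⟨M, hM⟩ := (Set.finite_range fun p : (ι → (X : Set (Fin r → ℤ))) × Fin r ↦
      (φ p.1 p.2).natAbs).bddAbove
    refine ⟨M, fun w i ↦ ?_⟩
    rw [Int.abs_eq_natAbs]
    exact_mod_cast hM ⟨(w, i), rfl⟩
  refine ⟨2 * M + 1, by omega, fun A hA hc ↦ ?_⟩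
  obtain ⟨s, hs⟩ := DensityHalesJewett.exists_add_mem_grid (lt_add_one _) hδ hA hc φ hM
  obtain ⟨l, hl⟩ := h _ hs
  obtain ⟨a, d, hd, had⟩ := DensityHalesJewett.sum_line_apply l
  refine ⟨s + a, d, hd, fun x hx ↦ ?_⟩
  rw [add_assoc, ← had ⟨x, hx⟩]
  exact hl ⟨x, hx⟩
end

section
/- Let k be a positive integer. For every a > 0 there exists c > 0 with the following property. Let H be a (k+1)-partite k-uniform hypergraph with vertex sets X_1,…,X_{k+1}, where |X_i| = N_i. Suppose that H contains at most c·∏_{i=1}^{k+1} N_i simplices. Then there is a subhypergraph H' ⊆ H containing no simplex such that for each i ≤ k+1 the number of edges of H ∖ H' with index [k+1]∖{i} (i.e., edges with one vertex in each X_j for j ≠ i) is at most a·∏_{j≠i} N_j. (Theorem 10.1, the simplex removal lemma.) -/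
namespace SimplexRemoval

open MeasureTheory Filter Topology ProbabilityTheory
open scoped ENNReal symmDiff

section Approximation

variable {Ω : Type*} {m0 : MeasurableSpace Ω} {μ : Measure Ω} [IsFiniteMeasure μ]
  {𝒜 : Set (Set Ω)}

/-- Sets of the `σ`-algebra generated by a set algebra are approximated by sets of the algebra. -/
lemma exists_symmDiff_lt (h𝒜 : IsSetAlgebra 𝒜) (hle : MeasurableSpace.generateFrom 𝒜 ≤ m0)
    {s : Set Ω} (hs : MeasurableSet[MeasurableSpace.generateFrom 𝒜] s) {ε : ℝ} (hε : 0 < ε) :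
    ∃ t ∈ 𝒜, μ.real (s ∆ t) < ε := by
  have hd := @Measure.MeasureDense.of_generateFrom_isSetAlgebra_finite Ω
    (MeasurableSpace.generateFrom 𝒜) (μ.trim hle) 𝒜 _ h𝒜 rfl
  obtain ⟨t, ht, h⟩ := @Measure.MeasureDense.approx Ω (MeasurableSpace.generateFrom 𝒜) _ _ hd s hs
    (measure_ne_top _ _) ε hε
  refine ⟨t, ht, ?_⟩
  rw [trim_measurableSet_eq hle
    (MeasurableSet.symmDiff hs (MeasurableSpace.measurableSet_generateFrom ht))] at h
  rw [measureReal_def]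
  exact (ENNReal.lt_ofReal_iff_toReal_lt (measure_ne_top _ _)).1 h

/-- Integrable functions measurable with respect to the `σ`-algebra generated by a set algebra are
approximated in `L¹` by simple functions over the algebra. -/
lemma exists_simple_approx (h𝒜 : IsSetAlgebra 𝒜) (hle : MeasurableSpace.generateFrom 𝒜 ≤ m0)
    {f : Ω → ℝ} (hf : Integrable f μ) (hfm : StronglyMeasurable[MeasurableSpace.generateFrom 𝒜] f)
    {ε : ℝ} (hε : 0 < ε) :
    ∃ (J : Type) (_ : Fintype J) (c : J → ℝ) (F : J → Set Ω), (∀ j, F j ∈ 𝒜) ∧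
      ∫ ω, |f ω - ∑ j, (F j).indicator (fun _ => c j) ω| ∂μ ≤ ε := by
  let P : (Ω → ℝ) → Prop := fun g => ∃ (J : Type) (_ : Fintype J) (c : J → ℝ) (F : J → Set Ω),
    (∀ j, F j ∈ 𝒜) ∧ g = fun ω => ∑ j, (F j).indicator (fun _ => c j) ω
  have hmeas : ∀ g, P g → StronglyMeasurable[MeasurableSpace.generateFrom 𝒜] g := by
    rintro g ⟨J, _, c, F, hF, rfl⟩
    refine Finset.stronglyMeasurable_fun_sum _ fun j _ => ?_
    exact stronglyMeasurable_const.indicator (MeasurableSpace.measurableSet_generateFrom (hF j))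
  have hmem : MemLp f 1 (μ.trim hle) :=
    memLp_one_iff_integrable.2 (hf.trim hle hfm)
  obtain ⟨g, hg, hP⟩ := @MemLp.induction_dense Ω ℝ (MeasurableSpace.generateFrom 𝒜) _ 1
    (μ.trim hle) (by simp) P (by
      intro c s hs _ ε hε
      obtain ⟨η, hη, hη'⟩ : ∃ η : ℝ, 0 < η ∧ ENNReal.ofReal (|c| * η) ≤ ε := by
        rcases eq_or_ne ε ∞ with rfl | hε'
        · exact ⟨1, one_pos, le_top⟩
        · have h0 : 0 < ε.toReal := ENNReal.toReal_pos hε hε'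
          refine ⟨ε.toReal / (|c| + 1), by positivity, ?_⟩
          refine ENNReal.ofReal_le_of_le_toReal ?_
          rw [← mul_div_assoc, div_le_iff₀ (by positivity)]
          nlinarith [abs_nonneg c]
      obtain ⟨t, ht, hlt⟩ := exists_symmDiff_lt (μ := μ) h𝒜 hle hs hη
      refine ⟨t.indicator fun _ => c, ?_, Unit, inferInstance, fun _ => c, fun _ => t, fun _ => ht,
        by simp⟩
      have htm := MeasurableSpace.measurableSet_generateFrom ht
      have hsm : StronglyMeasurable[MeasurableSpace.generateFrom 𝒜]
          ((t.indicator fun _ => c) - s.indicator fun _ => c) :=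
        (stronglyMeasurable_const.indicator htm).sub (stronglyMeasurable_const.indicator hs)
      rw [eLpNorm_trim hle hsm]
      refine le_trans ?_ hη'
      have hnorm : eLpNorm ((t.indicator fun _ => c) - s.indicator fun _ => c) 1 μ
          = eLpNorm ((s ∆ t).indicator fun _ => c) 1 μ := by
        rw [eLpNorm_one_eq_lintegral_enorm, eLpNorm_one_eq_lintegral_enorm]
        congr 1
        ext ω
        by_cases h1 : ω ∈ s <;> by_cases h2 : ω ∈ t <;>
          simp [h1, h2, Set.indicator, Set.mem_symmDiff]
      rw [hnorm, eLpNorm_indicator_const (hle _ (MeasurableSet.symmDiff hs htm)) (by simp)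
        (by simp)]
      rw [ENNReal.ofReal_mul (abs_nonneg c)]
      simp only [ENNReal.toReal_one, div_one, ENNReal.rpow_one]
      gcongr
      · rw [← Real.norm_eq_abs, ofReal_norm]
      · rw [← ofReal_measureReal]
        exact ENNReal.ofReal_le_ofReal hlt.le)
    (by
      rintro _ _ ⟨J, _, c, F, hF, rfl⟩ ⟨J', _, c', F', hF', rfl⟩
      refine ⟨J ⊕ J', inferInstance, Sum.elim c c', Sum.elim F F', ?_, ?_⟩
      · rintro (j | j)
        exacts [hF j, hF' j]
      · ext ω
        simp)
    (fun g hg => (hmeas g hg).aestronglyMeasurable) f hmem _ (ENNReal.ofReal_pos.2 hε).ne'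
  have hgm := hmeas g hP
  obtain ⟨J, hJ, c, F, hF, rfl⟩ := hP
  refine ⟨J, hJ, c, F, hF, ?_⟩
  rw [eLpNorm_trim hle (hfm.sub hgm), eLpNorm_one_eq_lintegral_enorm] at hg
  have := integral_norm_eq_lintegral_enorm (μ := μ)
    ((hfm.sub hgm).mono hle).aestronglyMeasurable
  simp only [Pi.sub_apply, Real.norm_eq_abs] at this
  rw [this]
  exact ENNReal.toReal_le_of_le_ofReal hε.le hg

end Approximation

variable {V Ω : Type*}

/-- The `σ`-algebra generated by the algebras `A g` for `g ∈ D`. -/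
@[reducible] def join (A : Finset V → Set (Set Ω)) (D : Set (Finset V)) : MeasurableSpace Ω :=
  MeasurableSpace.generateFrom (⋃ g ∈ D, A g)

lemma measurableSet_join {A : Finset V → Set (Set Ω)} {D : Set (Finset V)} {g : Finset V}
    (hg : g ∈ D) {s : Set Ω} (hs : s ∈ A g) : MeasurableSet[join A D] s :=
  MeasurableSpace.measurableSet_generateFrom (Set.mem_biUnion hg hs)

lemma join_le {A : Finset V → Set (Set Ω)} {D : Set (Finset V)} {m : MeasurableSpace Ω}
    (h : ∀ g ∈ D, ∀ s ∈ A g, MeasurableSet[m] s) : join A D ≤ m := by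
  refine MeasurableSpace.generateFrom_le fun s hs => ?_
  obtain ⟨g, hg, hs⟩ := Set.mem_iUnion₂.1 hs
  exact h g hg s hs

/-- A monotone family of set algebras indexed by sets of coordinates such that the correlation of
a simple function over `A S` with an intersection of sets from algebras `A h` never decreases for
some replacement of these sets by sets of the algebras `A (h ∩ S)`. -/
structure IsSliceable [DecidableEq V] [MeasurableSpace Ω] (μ : Measure Ω)
    (A : Finset V → Set (Set Ω)) :
    Prop where
  isSetAlgebra : ∀ g, IsSetAlgebra (A g)
  mono : Monotone A
  measurableSet : ∀ g, ∀ s ∈ A g, MeasurableSet s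
  slice : ∀ (S : Finset V) (J : Type) [Fintype J] (c : J → ℝ) (F : J → Set Ω),
    (∀ j, F j ∈ A S) → ∀ (t : Finset (Finset V)) (C : Finset V → Set Ω), (∀ h ∈ t, C h ∈ A h) →
    ∃ C' : Finset V → Set Ω, (∀ h ∈ t, C' h ∈ A (h ∩ S)) ∧
      ∑ j, c j * μ.real (F j ∩ ⋂ h ∈ t, C h) ≤ ∑ j, c j * μ.real (F j ∩ ⋂ h ∈ t, C' h)

namespace IsSliceable

variable [DecidableEq V] [m0 : MeasurableSpace Ω] {μ : Measure Ω}
  {A : Finset V → Set (Set Ω)}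

lemma join_le (hA : IsSliceable μ A) (D : Set (Finset V)) : join A D ≤ m0 :=
  SimplexRemoval.join_le fun g _ => hA.measurableSet g

lemma generateFrom_le (hA : IsSliceable μ A) (g : Finset V) :
    MeasurableSpace.generateFrom (A g) ≤ m0 :=
  MeasurableSpace.generateFrom_le (hA.measurableSet g)

variable [IsProbabilityMeasure μ]

lemma setIntegral_nonpos (hA : IsSliceable μ A) {S : Finset V} {D : Set (Finset V)} {f : Ω → ℝ}
    (hf : Integrable f μ) (hfm : StronglyMeasurable[MeasurableSpace.generateFrom (A S)] f)
    (h0 : ∀ s, MeasurableSet[join A ((· ∩ S) '' D)] s → ∫ ω in s, f ω ∂μ = 0)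
    (t : Finset (Finset V)) (htD : ↑t ⊆ D) (C : Finset V → Set Ω) (hC : ∀ h ∈ t, C h ∈ A h) :
    ∫ ω in ⋂ h ∈ t, C h, f ω ∂μ ≤ 0 := by
  refine le_of_forall_pos_le_add fun ε hε => ?_
  obtain ⟨J, _, c, F, hF, hfF⟩ :=
    exists_simple_approx (hA.isSetAlgebra S) (hA.generateFrom_le S) hf hfm (half_pos hε)
  have hFm : ∀ j, MeasurableSet (F j) := fun j => hA.measurableSet S _ (hF j)
  set g : Ω → ℝ := fun ω => ∑ j, (F j).indicator (fun _ => c j) ω with hg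
  have hgi : Integrable g μ :=
    integrable_finsetSum _ fun j _ => (integrable_const (c j)).indicator (hFm j)
  have hclose : ∀ s, MeasurableSet s → |∫ ω in s, f ω ∂μ - ∫ ω in s, g ω ∂μ| ≤ ε / 2 := by
    intro s hs
    rw [← integral_sub hf.integrableOn hgi.integrableOn]
    refine (abs_integral_le_integral_abs).trans (le_trans ?_ hfF)
    exact setIntegral_le_integral (hf.sub hgi).abs (Eventually.of_forall fun _ => abs_nonneg _)
  have hgint : ∀ s, MeasurableSet s → ∫ ω in s, g ω ∂μ = ∑ j, c j * μ.real (F j ∩ s) := by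
    intro s hs
    rw [hg, integral_finsetSum _ fun j _ =>
      ((integrable_const (c j)).indicator (hFm j)).integrableOn]
    refine Finset.sum_congr rfl fun j _ => ?_
    rw [integral_indicator (hFm j), Measure.restrict_restrict (hFm j)]
    simp [mul_comm]
  obtain ⟨C', hC', hle⟩ := hA.slice S J c F hF t C hC
  have hCm : MeasurableSet (⋂ h ∈ t, C h) :=
    Finset.measurableSet_biInter _ fun h hh => hA.measurableSet h _ (hC h hh)
  have hCm' : MeasurableSet[join A ((· ∩ S) '' D)] (⋂ h ∈ t, C' h) :=
    Finset.measurableSet_biInter _ fun h hh =>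
      measurableSet_join (Set.mem_image_of_mem _ (htD hh)) (hC' h hh)
  rw [← hgint _ hCm, ← hgint _ (hA.join_le _ _ hCm')] at hle
  have h1 := abs_le.1 (hclose _ hCm)
  have h2 := abs_le.1 (hclose _ (hA.join_le _ _ hCm'))
  rw [h0 _ hCm'] at h2
  linarith [h1.2, h2.1]

/-- Conditioning a set depending on `S` on the algebras `A h`, `h ∈ D`, only involves the algebras
`A (h ∩ S)`. -/
lemma condExp_join (hA : IsSliceable μ A) {S : Finset V} (D : Set (Finset V)) {B : Set Ω}
    (hB : MeasurableSet[MeasurableSpace.generateFrom (A S)] B) :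
    μ⟦B | join A D⟧ =ᵐ[μ] μ⟦B | join A ((· ∩ S) '' D)⟧ := by
  have hNS : join A ((· ∩ S) '' D) ≤ MeasurableSpace.generateFrom (A S) := by
    refine SimplexRemoval.join_le ?_
    rintro _ ⟨h, _, rfl⟩ s hs
    exact MeasurableSpace.measurableSet_generateFrom (hA.mono Finset.inter_subset_right hs)
  have hND : join A ((· ∩ S) '' D) ≤ join A D := by
    refine SimplexRemoval.join_le ?_
    rintro _ ⟨h, hh, rfl⟩ s hs
    exact measurableSet_join hh (hA.mono Finset.inter_subset_left hs)
  have hB0 : MeasurableSet B := hA.generateFrom_le S _ hB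
  have hBi : Integrable (B.indicator fun _ => (1 : ℝ)) μ := (integrable_const 1).indicator hB0
  set f : Ω → ℝ := (B.indicator fun _ => (1 : ℝ)) - μ⟦B | join A ((· ∩ S) '' D)⟧ with hf
  have hfi : Integrable f μ := hBi.sub integrable_condExp
  have hfm : StronglyMeasurable[MeasurableSpace.generateFrom (A S)] f :=
    (stronglyMeasurable_const.indicator hB).sub (stronglyMeasurable_condExp.mono hNS)
  have hf0 : ∀ s, MeasurableSet[join A ((· ∩ S) '' D)] s → ∫ ω in s, f ω ∂μ = 0 := by
    intro s hs
    simp only [hf, Pi.sub_apply]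
    rw [integral_sub hBi.integrableOn integrable_condExp.integrableOn,
      setIntegral_condExp (hA.join_le _) hBi hs, sub_self]
  have key : ∀ s, MeasurableSet[join A D] s → ∫ ω in s, f ω ∂μ = 0 := by
    intro s hs
    have hgen : join A D = MeasurableSpace.generateFrom (piiUnionInter A D) := by
      refine le_antisymm (SimplexRemoval.join_le fun g hg s hs =>
        MeasurableSpace.measurableSet_generateFrom (subset_piiUnionInter hg hs))
        (MeasurableSpace.generateFrom_le ?_)
      rintro _ ⟨t, ht, C, hC, rfl⟩
      exact Finset.measurableSet_biInter _ fun h hh => measurableSet_join (ht hh) (hC h hh)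
    have huniv : ∫ ω, f ω ∂μ = 0 := by simpa using hf0 Set.univ MeasurableSet.univ
    induction s, hs using MeasurableSpace.induction_on_inter hgen
      (isPiSystem_piiUnionInter A (fun g => (hA.isSetAlgebra g).isSetRing.isSetSemiring.isPiSystem)
        D) with
    | empty => simp
    | basic s hs =>
      obtain ⟨t, ht, C, hC, rfl⟩ := hs
      refine le_antisymm (hA.setIntegral_nonpos hfi hfm hf0 t ht C hC) ?_
      have := hA.setIntegral_nonpos hfi.neg hfm.neg (fun s hs => by
        simp only [Pi.neg_apply, integral_neg, hf0 s hs, neg_zero]) t ht C hC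
      simp only [Pi.neg_apply, integral_neg] at this
      linarith
    | compl s hs ih =>
      rw [setIntegral_compl (hA.join_le _ _ hs) hfi, ih, huniv, sub_zero]
    | iUnion s hd hs ih =>
      rw [integral_iUnion (fun i => hA.join_le _ _ (hs i)) hd hfi.integrableOn]
      simp [ih]
  refine (ae_eq_condExp_of_forall_setIntegral_eq (hA.join_le D) hBi
    (fun _ _ _ => integrable_condExp.integrableOn) (fun s hs _ => ?_)
    (stronglyMeasurable_condExp.mono hND).aestronglyMeasurable).symm
  have := key s hs
  simp only [hf, Pi.sub_apply] at this
  rw [integral_sub hBi.integrableOn integrable_condExp.integrableOn] at this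
  linarith

end IsSliceable

section CondExp

variable {m0 : MeasurableSpace Ω} {μ : Measure Ω} [IsFiniteMeasure μ]

/-- If conditioning `B` on `M` already gives an `N`-measurable function for some `N ≤ M`, then `B`
is conditionally independent of every `M`-measurable set given `N`. -/
lemma condExp_inter_of_condExp_ae_eq {N M : MeasurableSpace Ω} (hNM : N ≤ M) (hM : M ≤ m0)
    {B C : Set Ω} (hB : MeasurableSet[m0] B) (hC : MeasurableSet[M] C) {p : Ω → ℝ}
    (hp : StronglyMeasurable[N] p) (hBp : μ⟦B | M⟧ =ᵐ[μ] p) :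
    μ⟦B ∩ C | N⟧ =ᵐ[μ] μ⟦B | N⟧ * μ⟦C | N⟧ := by
  have hBi : Integrable (B.indicator fun _ => (1 : ℝ)) μ := (integrable_const 1).indicator hB
  have hCi : Integrable (C.indicator fun _ => (1 : ℝ)) μ :=
    (integrable_const 1).indicator (hM _ hC)
  have hpi : Integrable p μ := integrable_condExp.congr hBp
  have hmul : ((B ∩ C).indicator fun _ => (1 : ℝ)) =
      (B.indicator fun _ => (1 : ℝ)) * C.indicator fun _ => (1 : ℝ) := by
    ext ω
    by_cases h1 : ω ∈ B <;> by_cases h2 : ω ∈ C <;> simp [h1, h2]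
  have hmuli : Integrable ((B.indicator fun _ => (1 : ℝ)) * C.indicator fun _ => (1 : ℝ)) μ := by
    rw [← hmul]
    exact (integrable_const 1).indicator (hB.inter (hM _ hC))
  have hpC : p * (C.indicator fun _ => (1 : ℝ)) = C.indicator p := by
    ext ω
    by_cases h2 : ω ∈ C <;> simp [h2]
  have hpCi : Integrable (p * C.indicator fun _ => (1 : ℝ)) μ := by
    rw [hpC]
    exact hpi.indicator (hM _ hC)
  have h1 : μ⟦B ∩ C | M⟧ =ᵐ[μ] p * C.indicator fun _ => (1 : ℝ) := by
    rw [hmul]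
    refine (condExp_mul_of_stronglyMeasurable_right (stronglyMeasurable_const.indicator hC) hmuli
      hBi).trans ?_
    filter_upwards [hBp] with ω hω
    simp [hω]
  have h2 : μ⟦B | N⟧ =ᵐ[μ] p := by
    refine (condExp_condExp_of_le hNM hM).symm.trans ?_
    refine (condExp_congr_ae hBp).trans ?_
    rw [condExp_of_stronglyMeasurable (hNM.trans hM) hp hpi]
  refine (condExp_condExp_of_le hNM hM).symm.trans ((condExp_congr_ae h1).trans ?_)
  refine (condExp_mul_of_stronglyMeasurable_left hp hpCi hCi).trans ?_
  filter_upwards [h2] with ω hω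
  simp [hω]

/-- A set `R` that is close to a union of colour classes of `Ψ` lies mostly in those classes which,
conditionally on `N`, have positive probability and are almost contained in `R`. -/
lemma measureReal_irregular_le {N : MeasurableSpace Ω} (hN : N ≤ m0) {σ : Type*} [Fintype σ]
    {Ψ : Ω → σ} (hΨ : ∀ s, MeasurableSet[m0] (Ψ ⁻¹' {s})) {R : Set Ω} (hR : MeasurableSet[m0] R)
    (T : Set σ) {δ : ℝ} (hδ : 0 < δ) :
    μ.real {ω | ω ∈ R ∧ ¬ ((μ⟦Ψ ⁻¹' {Ψ ω} \ R | N⟧) ω ≤ δ * (μ⟦Ψ ⁻¹' {Ψ ω} | N⟧) ω ∧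
      0 < (μ⟦Ψ ⁻¹' {Ψ ω} | N⟧) ω)} ≤ (1 + 1 / δ) * μ.real (R ∆ (Ψ ⁻¹' T)) := by
  classical
  have hint : ∀ {B W : Set Ω}, MeasurableSet[m0] B → MeasurableSet[N] W →
      ∫ ω in W, (μ⟦B | N⟧) ω ∂μ = μ.real (B ∩ W) := by
    intro B W hB hW
    rw [setIntegral_condExp hN ((integrable_const 1).indicator hB) hW, integral_indicator hB,
      Measure.restrict_restrict hB]
    simp
  have hmeas : ∀ B : Set Ω, Measurable[N] (μ⟦B | N⟧) := fun B =>
    stronglyMeasurable_condExp.measurable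
  let Z : σ → Set Ω := fun s => Ψ ⁻¹' {s} ∩ {ω | (μ⟦Ψ ⁻¹' {s} | N⟧) ω ≤ 0}
  let W : σ → Set Ω := fun s =>
    Ψ ⁻¹' {s} ∩ {ω | δ * (μ⟦Ψ ⁻¹' {s} | N⟧) ω ≤ (μ⟦Ψ ⁻¹' {s} \ R | N⟧) ω}
  have hZ : ∀ s, μ.real (Z s) = 0 := by
    intro s
    have hm : MeasurableSet[N] {ω | (μ⟦Ψ ⁻¹' {s} | N⟧) ω ≤ 0} :=
      measurableSet_le (mδ := N) (hmeas _) measurable_const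
    refine le_antisymm ?_ measureReal_nonneg
    rw [← hint (hΨ s) hm]
    exact setIntegral_nonpos (hN _ hm) fun ω hω => hω
  have hW : ∀ s, μ.real (W s) ≤ 1 / δ * μ.real (Ψ ⁻¹' {s} \ R) := by
    intro s
    have hm : MeasurableSet[N]
        {ω | δ * (μ⟦Ψ ⁻¹' {s} | N⟧) ω ≤ (μ⟦Ψ ⁻¹' {s} \ R | N⟧) ω} :=
      measurableSet_le (mδ := N) ((hmeas _).const_mul δ) (hmeas _)
    have h1 : δ * μ.real (W s) ≤ μ.real (Ψ ⁻¹' {s} \ R) := by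
      rw [← hint (hΨ s) hm, ← integral_const_mul]
      refine le_trans (setIntegral_mono_on (integrable_condExp.const_mul δ).integrableOn
        integrable_condExp.integrableOn (hN _ hm) fun ω hω => hω) ?_
      rw [hint ((hΨ s).diff hR) hm]
      exact measureReal_mono Set.inter_subset_left
    rw [one_div, ← div_eq_inv_mul, le_div_iff₀ hδ]
    linarith
  have hsub : {ω | ω ∈ R ∧ ¬ ((μ⟦Ψ ⁻¹' {Ψ ω} \ R | N⟧) ω ≤ δ * (μ⟦Ψ ⁻¹' {Ψ ω} | N⟧) ω ∧
      0 < (μ⟦Ψ ⁻¹' {Ψ ω} | N⟧) ω)} ⊆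
      (R \ Ψ ⁻¹' T) ∪ ((⋃ s ∈ (Finset.univ : Finset σ), Z s) ∪
        ⋃ s ∈ Finset.univ.filter (· ∈ T), W s) := by
    rintro ω ⟨hωR, hω⟩
    by_cases hT : Ψ ω ∈ T
    · right
      by_cases h : (μ⟦Ψ ⁻¹' {Ψ ω} | N⟧) ω ≤ 0
      · exact Or.inl (Set.mem_biUnion (Finset.mem_coe.2 (Finset.mem_univ (Ψ ω))) ⟨rfl, h⟩)
      · refine Or.inr (Set.mem_biUnion (x := Ψ ω) (by simpa using hT) ⟨rfl, ?_⟩)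
        by_contra hlt
        exact hω ⟨(not_le.1 hlt).le, not_le.1 h⟩
    · exact Or.inl ⟨hωR, hT⟩
  have hsum : ∑ s with s ∈ T, μ.real (Ψ ⁻¹' {s} \ R) = μ.real (Ψ ⁻¹' T \ R) := by
    rw [← measureReal_biUnion_finset]
    · congr 1
      ext ω
      simp
    · intro s _ s' _ hss'
      refine Set.disjoint_left.2 fun ω h1 h2 => hss' ?_
      exact h1.1.symm.trans h2.1
    · exact fun s _ => (hΨ s).diff hR
  have hdiff1 : μ.real (R \ Ψ ⁻¹' T) ≤ μ.real (R ∆ (Ψ ⁻¹' T)) :=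
    measureReal_mono Set.subset_union_left
  have hdiff2 : μ.real (Ψ ⁻¹' T \ R) ≤ μ.real (R ∆ (Ψ ⁻¹' T)) :=
    measureReal_mono Set.subset_union_right
  calc _ ≤ μ.real (R \ Ψ ⁻¹' T) + (∑ s, μ.real (Z s) + ∑ s with s ∈ T, μ.real (W s)) := by
        refine (measureReal_mono hsub).trans ((measureReal_union_le _ _).trans ?_)
        gcongr
        refine (measureReal_union_le _ _).trans ?_
        gcongr <;> exact measureReal_biUnion_finset_le _ _
    _ ≤ μ.real (R \ Ψ ⁻¹' T) + 1 / δ * μ.real (Ψ ⁻¹' T \ R) := by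
        simp only [hZ, Finset.sum_const_zero, zero_add]
        rw [← hsum, Finset.mul_sum]
        gcongr
        exact hW _
    _ ≤ μ.real (R ∆ (Ψ ⁻¹' T)) + 1 / δ * μ.real (R ∆ (Ψ ⁻¹' T)) := by gcongr
    _ = _ := by ring

end CondExp

section Coloring

lemma setOf_coloring_mem {𝒜 : Set (Set Ω)} (h𝒜 : IsSetAlgebra 𝒜) {ι κ : Type*} [Finite ι] [Finite κ]
    (ψ : ι → Ω → κ) (hψ : ∀ i t, ψ i ⁻¹' {t} ∈ 𝒜) (T : Set (ι → κ)) :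
    {ω | (fun i => ψ i ω) ∈ T} ∈ 𝒜 := by
  classical
  cases nonempty_fintype ι
  cases nonempty_fintype κ
  have : {ω | (fun i => ψ i ω) ∈ T} =
      ⋃ b ∈ Finset.univ.filter (· ∈ T), ⋂ i ∈ (Finset.univ : Finset ι), ψ i ⁻¹' {b i} := by
    ext ω
    simp only [Set.mem_ofPred_eq, Finset.mem_filter, Finset.mem_univ, true_and, Set.mem_iUnion,
      Set.iInter_true, Set.mem_iInter, Set.mem_preimage, Set.mem_singleton_iff, exists_prop]
    refine ⟨fun h => ⟨_, h, fun _ => rfl⟩, ?_⟩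
    rintro ⟨b, hb, h⟩
    rwa [show (fun i => ψ i ω) = b from funext h]
  rw [this]
  exact h𝒜.biUnion_mem _ fun b _ => h𝒜.biInter_mem _ fun i _ => hψ i _

lemma isSetAlgebra_measurableSet (m : MeasurableSpace Ω) :
    IsSetAlgebra {s : Set Ω | MeasurableSet[m] s} where
  empty_mem := MeasurableSet.empty
  compl_mem _ hs := MeasurableSet.compl hs
  union_mem _ _ hs ht := MeasurableSet.union hs ht

/-- Sets in the join of finitely many algebras are approximated by unions of cells of a finite
colouring. -/
lemma exists_coloring_approx [m0 : MeasurableSpace Ω] {μ : Measure Ω} [IsFiniteMeasure μ]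
    {A : Finset V → Set (Set Ω)} (hA : ∀ g, IsSetAlgebra (A g))
    (hAm : ∀ g, ∀ s ∈ A g, MeasurableSet s) (D : Finset (Finset V))
    {s : Set Ω} (hs : MeasurableSet[join A D] s) {ε : ℝ} (hε : 0 < ε) :
    ∃ (κ : Type) (_ : Fintype κ) (ψ : Finset V → Ω → κ), (∀ g t, ψ g ⁻¹' {t} ∈ A g) ∧
      ∃ T : Set (D → κ), μ.real (s ∆ {ω | (fun g : D => ψ g ω) ∈ T}) < ε := by
  classical
  let 𝒞 : Set (Set Ω) := {s | ∃ (κ : Type) (_ : Fintype κ) (ψ : Finset V → Ω → κ),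
    (∀ g t, ψ g ⁻¹' {t} ∈ A g) ∧ ∃ T : Set (D → κ), s = {ω | (fun g : D => ψ g ω) ∈ T}}
  have h𝒞 : IsSetAlgebra 𝒞 := by
    refine ⟨⟨Unit, inferInstance, fun _ _ => (), fun g t => ?_, ∅, by simp⟩, ?_, ?_⟩
    · convert (hA g).univ_mem
      ext; simp
    · rintro _ ⟨κ, hκ, ψ, hψ, T, rfl⟩
      exact ⟨κ, hκ, ψ, hψ, Tᶜ, rfl⟩
    · rintro _ _ ⟨κ, hκ, ψ, hψ, T, rfl⟩ ⟨κ', hκ', ψ', hψ', T', rfl⟩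
      refine ⟨κ × κ', inferInstance, fun g ω => (ψ g ω, ψ' g ω), fun g t => ?_,
        {b | (fun g => (b g).1) ∈ T ∨ (fun g => (b g).2) ∈ T'}, rfl⟩
      convert (hA g).inter_mem (hψ g t.1) (hψ' g t.2)
      ext ω
      simp [Prod.ext_iff]
  have hle : MeasurableSpace.generateFrom 𝒞 ≤ m0 := by
    refine MeasurableSpace.generateFrom_le ?_
    rintro _ ⟨κ, hκ, ψ, hψ, T, rfl⟩
    exact setOf_coloring_mem (isSetAlgebra_measurableSet m0) (fun g : D => ψ g)
      (fun g t => hAm g _ (hψ g t)) T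
  have hjoin : join A D ≤ MeasurableSpace.generateFrom 𝒞 := by
    refine join_le fun g hg s hs => MeasurableSpace.measurableSet_generateFrom ?_
    refine ⟨Bool, inferInstance, fun h ω => decide (h = g ∧ ω ∈ s), fun h t => ?_,
      {b | b ⟨g, hg⟩ = true}, by ext; simp⟩
    by_cases hh : h = g
    · subst hh
      cases t
      · convert (hA h).compl_mem hs
        ext; simp
      · convert hs
        ext; simp
    · cases t
      · convert (hA h).univ_mem
        ext; simp [hh]
      · convert (hA h).empty_mem
        ext; simp [hh]
  obtain ⟨_, ⟨κ, hκ, ψ, hψ, T, rfl⟩, h⟩ := exists_symmDiff_lt (μ := μ) h𝒞 hle (hjoin _ hs) hε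
  exact ⟨κ, hκ, ψ, hψ, T, h⟩

end Coloring

/-- The `σ`-algebra generated by the algebras `A g` for `g ⊆ S` of size less than `d`. -/
@[reducible] def level (A : Finset V → Set (Set Ω)) (d : ℕ) (S : Finset V) : MeasurableSpace Ω :=
  join A {g | g ⊆ S ∧ g.card < d}

namespace IsSliceable

variable [Fintype V] [DecidableEq V] [m0 : MeasurableSpace Ω] {μ : Measure Ω}
  [IsProbabilityMeasure μ] {A : Finset V → Set (Set Ω)}

lemma condExp_level (hA : IsSliceable μ A) (d : ℕ) {S : Finset V} {B : Set Ω}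
    (hB : MeasurableSet[MeasurableSpace.generateFrom (A S)] B) :
    μ⟦B | level A d Finset.univ⟧ =ᵐ[μ] μ⟦B | level A d S⟧ := by
  convert hA.condExp_join {g | g ⊆ Finset.univ ∧ g.card < d} hB using 4
  ext g
  constructor
  · rintro ⟨h1, h2⟩
    exact ⟨g, ⟨Finset.subset_univ _, h2⟩, Finset.inter_eq_left.2 h1⟩
  · rintro ⟨h, ⟨_, h2⟩, rfl⟩
    exact ⟨Finset.inter_subset_right, (Finset.card_le_card Finset.inter_subset_left).trans_lt h2⟩

/-- Sets depending on `S` are conditionally independent, given the sets of level less than `d`, of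
sets depending on coordinate sets that meet `S` in fewer than `d` elements. -/
lemma condExp_inter (hA : IsSliceable μ A) (d : ℕ) {S : Finset V} {D : Set (Finset V)}
    (hD : ∀ h ∈ D, (h ∩ S).card < d) {B C : Set Ω}
    (hB : MeasurableSet[MeasurableSpace.generateFrom (A S)] B) (hC : MeasurableSet[join A D] C) :
    μ⟦B ∩ C | level A d Finset.univ⟧ =ᵐ[μ]
      μ⟦B | level A d Finset.univ⟧ * μ⟦C | level A d Finset.univ⟧ := by
  let D' : Set (Finset V) := D ∪ {g | g ⊆ Finset.univ ∧ g.card < d}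
  have hle : join A ((· ∩ S) '' D') ≤ level A d Finset.univ := by
    refine SimplexRemoval.join_le ?_
    rintro _ ⟨h, hh, rfl⟩ s hs
    refine measurableSet_join (g := h ∩ S) (And.intro (Finset.subset_univ _) ?_) hs
    rcases hh with hh | hh
    · exact hD h hh
    · exact (Finset.card_le_card Finset.inter_subset_left).trans_lt hh.2
  have hNM : level A d Finset.univ ≤ join A D' :=
    SimplexRemoval.join_le fun g hg s hs => measurableSet_join (Or.inr hg) hs
  have hDM : join A D ≤ join A D' :=
    SimplexRemoval.join_le fun g hg s hs => measurableSet_join (Or.inl hg) hs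
  exact condExp_inter_of_condExp_ae_eq hNM (hA.join_le _) (hA.generateFrom_le S _ hB) (hDM _ hC)
    (stronglyMeasurable_condExp.mono hle) (hA.condExp_join D' hB)

lemma condExp_biInter (hA : IsSliceable μ A) (d : ℕ) (G : Finset (Finset V))
    (hG : ∀ g ∈ G, g.card = d) (B : Finset V → Set Ω) (hB : ∀ g, B g ∈ A g) :
    μ⟦⋂ g ∈ G, B g | level A d Finset.univ⟧ =ᵐ[μ]
      fun ω => ∏ g ∈ G, (μ⟦B g | level A d Finset.univ⟧) ω := by
  induction G using Finset.induction_on with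
  | empty =>
    simp [condExp_const (hA.join_le _)]
  | insert g G hg ih =>
    rw [Finset.set_biInter_insert]
    have hC : MeasurableSet[join A ↑G] (⋂ h ∈ G, B h) :=
      Finset.measurableSet_biInter _ fun h hh => measurableSet_join hh (hB h)
    have hD : ∀ h ∈ (↑G : Set (Finset V)), (h ∩ g).card < d := by
      intro h hh
      have hc := hG h (Finset.mem_insert_of_mem hh)
      have hc' := hG g (Finset.mem_insert_self _ _)
      rw [← hc]
      refine Finset.card_lt_card (ssubset_iff_subset_not_subset.2 ⟨Finset.inter_subset_left,
        fun hsub => hg ?_⟩)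
      have : h = g := Finset.eq_of_subset_of_card_le (hsub.trans Finset.inter_subset_right)
        (by omega)
      rwa [← this]
    filter_upwards [hA.condExp_inter d hD (MeasurableSpace.measurableSet_generateFrom (hB g)) hC,
      ih fun h hh => hG h (Finset.mem_insert_of_mem hh)] with ω h1 h2
    rw [h1, Finset.prod_insert hg, Pi.mul_apply, h2]

/-- If the sets `R i` have null intersection, then so do the sets where the cell of level `d`
below `i` has positive conditional probability and is almost contained in `R i`. -/
lemma measure_iInter_regular_eq_zero (hA : IsSliceable μ A) {d : ℕ} (hd : d < Fintype.card V)
    (B : Finset V → Set Ω) (hB : ∀ g, B g ∈ A g) (R : V → Set Ω)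
    (hR : ∀ i, MeasurableSet[MeasurableSpace.generateFrom (A (Finset.univ.erase i))] (R i))
    (hR0 : μ (⋂ i, R i) = 0) {δ : ℝ} (hδ : δ * Fintype.card V < 1) (Q : V → Set Ω)
    (hQ : ∀ i, Q i = ⋂ g ∈ (Finset.univ.erase i).powersetCard d, B g) :
    μ (⋂ i, {ω | (μ⟦Q i \ R i | level A d (Finset.univ.erase i)⟧) ω ≤
        δ * (μ⟦Q i | level A d (Finset.univ.erase i)⟧) ω ∧
      0 < (μ⟦Q i | level A d (Finset.univ.erase i)⟧) ω}) = 0 := by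
  set G : Finset (Finset V) := Finset.univ.powersetCard d with hG
  have hGc : ∀ g ∈ G, g.card = d := fun g hg => (Finset.mem_powersetCard.1 hg).2
  set P : Set Ω := ⋂ g ∈ G, B g with hP
  let C : V → Set Ω := fun i => ⋂ g ∈ G.filter (i ∈ ·), B g
  have hPQ : ∀ i, P = Q i ∩ C i := by
    intro i
    rw [hQ]
    ext ω
    simp only [hP, C, hG, Set.mem_iInter, Set.mem_inter_iff, Finset.mem_filter,
      Finset.mem_powersetCard, Finset.subset_erase]
    constructor
    · exact fun h => ⟨fun g hg => h g ⟨hg.1.1, hg.2⟩, fun g hg => h g hg.1⟩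
    · intro h g hg
      by_cases hi : i ∈ g
      · exact h.2 g ⟨hg, hi⟩
      · exact h.1 g ⟨⟨hg.1, hi⟩, hg.2⟩
  have hQm : ∀ i, MeasurableSet[MeasurableSpace.generateFrom (A (Finset.univ.erase i))] (Q i) := by
    intro i
    rw [hQ]
    exact Finset.measurableSet_biInter _ fun g hg => MeasurableSpace.measurableSet_generateFrom
      (hA.mono (Finset.mem_powersetCard.1 hg).1 (hB g))
  have hCm : ∀ i, MeasurableSet[join A ↑(G.filter (i ∈ ·))] (C i) := fun i =>
    Finset.measurableSet_biInter _ fun g hg => measurableSet_join hg (hB g)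
  have hCD : ∀ i, ∀ h ∈ (↑(G.filter (i ∈ ·)) : Set (Finset V)),
      (h ∩ Finset.univ.erase i).card < d := by
    intro i h hh
    have hh' := Finset.mem_filter.1 (Finset.mem_coe.1 hh)
    rw [← hGc h hh'.1]
    refine Finset.card_lt_card (ssubset_iff_subset_not_subset.2 ⟨Finset.inter_subset_left,
      fun hsub => ?_⟩)
    have := Finset.mem_inter.1 (hsub hh'.2)
    simp at this
  have hPm : MeasurableSet P := Finset.measurableSet_biInter _ fun g _ =>
    hA.measurableSet g _ (hB g)
  have hRm : ∀ i, MeasurableSet (R i) := fun i => hA.generateFrom_le _ _ (hR i)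
  have hind : ∀ {s : Set Ω}, MeasurableSet s → Integrable (s.indicator fun _ => (1 : ℝ)) μ :=
    fun hs => (integrable_const 1).indicator hs
  have hsum : μ⟦P | level A d Finset.univ⟧ ≤ᵐ[μ]
      ∑ i, μ⟦P \ R i | level A d Finset.univ⟧ := by
    refine (condExp_mono (hind hPm) (integrable_finsetSum' Finset.univ
      fun i _ => hind (hPm.diff (hRm i))) ?_).trans
      (condExp_finsetSum (fun i _ => hind (hPm.diff (hRm i))) _).le
    filter_upwards [measure_eq_zero_iff_ae_notMem.1 hR0] with ω hω
    obtain ⟨i, hi⟩ : ∃ i, ω ∉ R i := by simpa using hω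
    by_cases hωP : ω ∈ P
    · rw [Finset.sum_apply, Set.indicator_of_mem hωP]
      refine le_trans ?_ (Finset.single_le_sum
        (fun j _ => Set.indicator_nonneg (fun _ _ => zero_le_one) ω) (Finset.mem_univ i))
      rw [Set.indicator_of_mem (Set.mem_sdiff_of_mem hωP hi)]
    · rw [Finset.sum_apply, Set.indicator_of_notMem hωP]
      exact Finset.sum_nonneg fun j _ => Set.indicator_nonneg (fun _ _ => zero_le_one) ω
  have hnonneg : ∀ s : Set Ω, 0 ≤ᵐ[μ] μ⟦s | level A d Finset.univ⟧ := fun s =>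
    condExp_nonneg (Eventually.of_forall fun ω => Set.indicator_nonneg (fun _ _ => zero_le_one) ω)
  have hdiff : ∀ i, μ⟦P \ R i | level A d Finset.univ⟧ =ᵐ[μ]
      μ⟦Q i \ R i | level A d Finset.univ⟧ * μ⟦C i | level A d Finset.univ⟧ := by
    intro i
    rw [hPQ i, Set.inter_sdiff_right_comm]
    exact hA.condExp_inter d (hCD i) (MeasurableSet.diff (hQm i) (hR i)) (hCm i)
  have hsplit : ∀ i, μ⟦P | level A d Finset.univ⟧ =ᵐ[μ]
      μ⟦Q i | level A d Finset.univ⟧ * μ⟦C i | level A d Finset.univ⟧ := by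
    intro i
    rw [hPQ i]
    exact hA.condExp_inter d (hCD i) (hQm i) (hCm i)
  have hprod := hA.condExp_biInter d G hGc B hB
  have hprodQ : ∀ i, μ⟦Q i | level A d Finset.univ⟧ =ᵐ[μ]
      fun ω => ∏ g ∈ (Finset.univ.erase i).powersetCard d,
        (μ⟦B g | level A d Finset.univ⟧) ω := by
    intro i
    rw [hQ]
    exact hA.condExp_biInter d _ (fun g hg => (Finset.mem_powersetCard.1 hg).2) B hB
  rw [measure_eq_zero_iff_ae_notMem]
  filter_upwards [hsum, hprod, ae_all_iff.2 hdiff, ae_all_iff.2 hsplit, ae_all_iff.2 hprodQ,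
    ae_all_iff.2 fun g => hnonneg (B g), ae_all_iff.2 fun i => hnonneg (C i),
    ae_all_iff.2 fun i => hA.condExp_level d (hQm i),
    ae_all_iff.2 fun i => hA.condExp_level d (MeasurableSet.diff (hQm i) (hR i))]
    with ω hsum hprod hdiff hsplit hprodQ hBn hCn hlQ hlD hω
  simp only [Set.mem_iInter, Set.mem_ofPred_eq, ← hlQ, ← hlD] at hω
  have hpos : 0 < (μ⟦P | level A d Finset.univ⟧) ω := by
    rw [hprod]
    refine Finset.prod_pos fun g hg => lt_of_le_of_ne (hBn g) fun h0 => ?_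
    obtain ⟨i, hi⟩ : ∃ i, i ∉ g := by
      by_contra! hall
      have : g = Finset.univ := Finset.eq_univ_iff_forall.2 hall
      have := hGc g hg
      simp_all
    have := (hω i).2
    rw [hprodQ, Finset.prod_eq_zero (i := g) _ h0.symm] at this
    · exact lt_irrefl _ this
    · exact Finset.mem_powersetCard.2 ⟨Finset.subset_erase.2 ⟨Finset.subset_univ _, hi⟩, hGc g hg⟩
  have hle : (μ⟦P | level A d Finset.univ⟧) ω ≤
      ∑ _i : V, δ * (μ⟦P | level A d Finset.univ⟧) ω := by
    rw [Finset.sum_apply] at hsum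
    refine hsum.trans (Finset.sum_le_sum fun i _ => ?_)
    rw [hdiff i, hsplit i, Pi.mul_apply, Pi.mul_apply, ← mul_assoc]
    exact mul_le_mul_of_nonneg_right (hω i).1 (hCn i)
  rw [Finset.sum_const, Finset.card_univ, nsmul_eq_mul] at hle
  nlinarith

end IsSliceable

lemma level_succ_le {A : Finset V → Set (Set Ω)} (hA : Monotone A) {d : ℕ} {S : Finset V}
    (hd : d ≤ S.card) : level A (d + 1) S ≤ join A ↑(S.powersetCard d) := by
  refine join_le fun g hg s hs => ?_
  obtain ⟨u, hgu, huS, hu⟩ := Finset.exists_subsuperset_card_eq hg.1 (Nat.lt_succ_iff.1 hg.2) hd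
  exact measurableSet_join (Finset.mem_coe.2 (Finset.mem_powersetCard.2 ⟨huS, hu⟩)) (hA hgu hs)

lemma measurableSet_level_zero {A : Finset V → Set (Set Ω)} {S : Finset V} {s : Set Ω}
    (hs : MeasurableSet[level A 0 S] s) : s = ∅ ∨ s = Set.univ := by
  have : level A 0 S ≤ ⊥ := join_le fun g hg => absurd hg.2 (Nat.not_lt_zero _)
  exact MeasurableSpace.measurableSet_bot_iff.1 (this _ hs)

namespace IsSliceable

variable {V Ω : Type} [Fintype V] [DecidableEq V] [m0 : MeasurableSpace Ω] {μ : Measure Ω}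
  [IsProbabilityMeasure μ] {A : Finset V → Set (Set Ω)}

/-- Removal for sets which are of level less than `d` within each cell of a finite colouring. -/
lemma exists_removal_of_coloring (hA : IsSliceable μ A) {d : ℕ} (hd : d ≤ Fintype.card V)
    {κ : Type} [Fintype κ] (φ : Finset V → Ω → κ) (hφ : ∀ g t, φ g ⁻¹' {t} ∈ A g)
    (R : V → (Finset V → κ) → Set Ω)
    (hR : ∀ i c, MeasurableSet[level A d (Finset.univ.erase i)] (R i c))
    (hRc : ∀ i c c', (∀ g ⊆ Finset.univ.erase i, c g = c' g) → R i c = R i c')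
    (h0 : ∀ c, μ (⋂ i, R i c) = 0) {ε : ℝ} (hε : 0 < ε) :
    ∃ F : V → Set Ω, (∀ i, F i ∈ A (Finset.univ.erase i)) ∧
      (∀ i, μ.real ({ω | ω ∈ R i (fun g => φ g ω)} \ F i) ≤ ε) ∧ ⋂ i, F i = ∅ := by
  classical
  induction d generalizing κ ε with
  | zero =>
    have hR' : ∀ i c, (R i c).Nonempty → R i c = Set.univ := fun i c hne =>
      (measurableSet_level_zero (hR i c)).resolve_left hne.ne_empty
    refine ⟨fun i => {ω | ω ∈ R i (fun g => φ g ω)}, fun i => ?_, fun i => ?_, ?_⟩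
    · convert setOf_coloring_mem (hA.isSetAlgebra (Finset.univ.erase i))
        (fun g : {g : Finset V // g ⊆ Finset.univ.erase i} => φ g)
        (fun g t => hA.mono g.2 (hφ g t))
        {b | ∃ c, (∀ g : {g : Finset V // g ⊆ Finset.univ.erase i}, c g = b g) ∧
          R i c = Set.univ} using 1
      ext ω
      constructor
      · exact fun h => ⟨fun g => φ g ω, fun _ => rfl, hR' i _ ⟨ω, h⟩⟩
      · rintro ⟨c, hc, hcR⟩
        have := hRc i c (fun g => φ g ω) fun g hg => hc ⟨g, hg⟩
        change ω ∈ R i (fun g => φ g ω)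
        rw [← this, hcR]
        trivial
    · simp [hε.le]
    · refine Set.eq_empty_of_forall_notMem fun ω hω => ?_
      have h := h0 fun g => φ g ω
      have hall : ∀ i, R i (fun g => φ g ω) = Set.univ := fun i =>
        hR' i _ ⟨ω, Set.mem_iInter.1 hω i⟩
      simp [hall] at h
  | succ d ih =>
    have hV : (0 : ℝ) < Fintype.card V := by exact_mod_cast (Nat.succ_pos d).trans_le hd
    set δ : ℝ := 1 / (2 * Fintype.card V) with hδ
    have hδ0 : 0 < δ := by positivity
    set η : ℝ := ε / 2 / (Fintype.card (Finset V → κ) + 1) / (1 + 1 / δ) with hη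
    have hη0 : 0 < η := by positivity
    let D : V → Finset (Finset V) := fun i => (Finset.univ.erase i).powersetCard d
    have hlev : ∀ i, level A (d + 1) (Finset.univ.erase i) ≤ join A ↑(D i) := fun i =>
      level_succ_le hA.mono (by
        rw [Finset.card_erase_of_mem (Finset.mem_univ i), Finset.card_univ]; omega)
    choose K hK ψ hψ T hT using fun p : V × (Finset V → κ) =>
      exists_coloring_approx (μ := μ) hA.isSetAlgebra hA.measurableSet (D p.1)
        (hlev p.1 _ (hR p.1 p.2))
        hη0
    let ψ' : Finset V → Ω → ∀ p, K p := fun g ω p => ψ p g ω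
    have hψ' : ∀ g t, ψ' g ⁻¹' {t} ∈ A g := by
      intro g t
      convert (hA.isSetAlgebra g).biInter_mem (s := fun p => ψ p g ⁻¹' {t p}) Finset.univ
        fun p _ => hψ p g (t p)
      ext ω
      simp [ψ', funext_iff]
    let Q : V → (Finset V → ∀ p, K p) → Set Ω := fun i b => ⋂ g ∈ D i, ψ' g ⁻¹' {b g}
    let R' : V → (Finset V → κ × ∀ p, K p) → Set Ω := fun i c =>
      {ω | (μ⟦Q i (fun g => (c g).2) \ R i (fun g => (c g).1) |
          level A d (Finset.univ.erase i)⟧) ω ≤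
        δ * (μ⟦Q i (fun g => (c g).2) | level A d (Finset.univ.erase i)⟧) ω ∧
        0 < (μ⟦Q i (fun g => (c g).2) | level A d (Finset.univ.erase i)⟧) ω}
    have hmeas : ∀ i (B : Set Ω), Measurable[level A d (Finset.univ.erase i)]
        (μ⟦B | level A d (Finset.univ.erase i)⟧) := fun i B =>
      stronglyMeasurable_condExp.measurable
    have hlevS : ∀ i, level A (d + 1) (Finset.univ.erase i) ≤
        MeasurableSpace.generateFrom (A (Finset.univ.erase i)) := fun i =>
      SimplexRemoval.join_le fun g hg s hs =>
        MeasurableSpace.measurableSet_generateFrom (hA.mono hg.1 hs)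
    obtain ⟨F, hF, hFε, hF0⟩ := ih (Nat.le_of_succ_le hd) (fun g ω => (φ g ω, ψ' g ω))
      (fun g t => by
        convert (hA.isSetAlgebra g).inter_mem (hφ g t.1) (hψ' g t.2)
        ext ω
        simp [Prod.ext_iff])
      R'
      (fun i c => MeasurableSet.inter
        (measurableSet_le (mδ := level A d (Finset.univ.erase i)) (hmeas i _)
          ((hmeas i _).const_mul δ))
        (measurableSet_lt (mδ := level A d (Finset.univ.erase i)) measurable_const (hmeas i _)))
      (fun i c c' hcc' => by
        have h1 : R i (fun g => (c g).1) = R i (fun g => (c' g).1) :=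
          hRc i _ _ fun g hg => by rw [hcc' g hg]
        have h2 : Q i (fun g => (c g).2) = Q i (fun g => (c' g).2) :=
          Set.iInter₂_congr fun g hg => by simp only [hcc' g (Finset.mem_powersetCard.1 hg).1]
        simp only [R', h1, h2])
      (fun c => hA.measure_iInter_regular_eq_zero hd (fun g => ψ' g ⁻¹' {(c g).2})
        (fun g => hψ' g _) (fun i => R i fun g => (c g).1) (fun i => hlevS i _ (hR i _)) (h0 _)
        (by rw [hδ]; field_simp; norm_num) _ fun i => rfl)
      (half_pos hε)
    refine ⟨F, hF, fun i => ?_, hF0⟩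
    let Ψ : Ω → (D i → ∀ p, K p) := fun ω g => ψ' g ω
    have hΨ : ∀ b : Finset V → ∀ p, K p, Ψ ⁻¹' {fun g : D i => b g} = Q i b := by
      intro b
      ext ω
      simp [Ψ, Q, funext_iff]
    have hΨm : ∀ s, MeasurableSet (Ψ ⁻¹' {s}) := fun s =>
      setOf_coloring_mem (isSetAlgebra_measurableSet m0) (fun g : D i => ψ' g)
        (fun g t => hA.measurableSet g _ (hψ' g t)) {s}
    let W : (Finset V → κ) → Set Ω := fun c => {ω | ω ∈ R i c ∧
      ¬ ((μ⟦Ψ ⁻¹' {Ψ ω} \ R i c | level A d (Finset.univ.erase i)⟧) ω ≤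
        δ * (μ⟦Ψ ⁻¹' {Ψ ω} | level A d (Finset.univ.erase i)⟧) ω ∧
        0 < (μ⟦Ψ ⁻¹' {Ψ ω} | level A d (Finset.univ.erase i)⟧) ω)}
    have hW : ∀ c, μ.real (W c) ≤ (1 + 1 / δ) * η := by
      intro c
      refine (measureReal_irregular_le (hA.join_le _) hΨm
          (hA.generateFrom_le _ _ (hlevS i _ (hR i c)))
        {b | (fun g => b g (i, c)) ∈ T (i, c)} hδ0).trans ?_
      gcongr
      exact (hT (i, c)).le
    have hsub : {ω | ω ∈ R i (fun g => φ g ω)} \ F i ⊆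
        (⋃ c ∈ (Finset.univ : Finset (Finset V → κ)), W c) ∪
          ({ω | ω ∈ R' i (fun g => (φ g ω, ψ' g ω))} \ F i) := by
      rintro ω ⟨hω, hωF⟩
      by_cases h : ω ∈ R' i (fun g => (φ g ω, ψ' g ω))
      · exact Or.inr ⟨h, hωF⟩
      · refine Or.inl (Set.mem_biUnion (x := fun g => φ g ω) (by simp) ⟨hω, ?_⟩)
        rwa [hΨ fun g => ψ' g ω]
    calc _ ≤ ∑ c, μ.real (W c) + ε / 2 :=
          (measureReal_mono hsub).trans ((measureReal_union_le _ _).trans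
            (add_le_add (measureReal_biUnion_finset_le _ _) (hFε i)))
      _ ≤ ∑ _c : Finset V → κ, (1 + 1 / δ) * η + ε / 2 := by
          gcongr
          exact hW _
      _ ≤ ε / 2 + ε / 2 := by
          gcongr
          rw [Finset.sum_const, Finset.card_univ, nsmul_eq_mul, hη,
            mul_div_cancel₀ _ (by positivity), mul_div_assoc', div_le_iff₀ (by positivity)]
          nlinarith
      _ = ε := add_halves ε

/-- The infinitary removal lemma. -/
lemma exists_removal (hA : IsSliceable μ A) (E : V → Set Ω)
    (hE : ∀ i, E i ∈ A (Finset.univ.erase i)) (h0 : μ (⋂ i, E i) = 0) {ε : ℝ} (hε : 0 < ε) :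
    ∃ F : V → Set Ω, (∀ i, F i ∈ A (Finset.univ.erase i)) ∧
      (∀ i, μ.real (E i \ F i) ≤ ε) ∧ ⋂ i, F i = ∅ :=
  hA.exists_removal_of_coloring le_rfl (fun _ _ => ())
    (fun g t => by
      convert (hA.isSetAlgebra g).univ_mem
      ext
      simp)
    (fun i _ => E i)
    (fun i _ => measurableSet_join (g := Finset.univ.erase i)
      (And.intro subset_rfl (by
        rw [← Finset.card_univ]
        exact Finset.card_erase_lt_of_mem (Finset.mem_univ i))) (hE i))
    (fun _ _ _ _ => rfl) (fun _ => h0) hε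

end IsSliceable

section Loeb

variable {Y : ℕ → Type*}

/-- The internal set determined by a sequence of sets: the points of the product whose coordinates
lie in the given sets almost always along a fixed nonprincipal ultrafilter. -/
def internal (A : ∀ n, Set (Y n)) : Set (∀ n, Y n) :=
  {ω | ∀ᶠ n in (hyperfilter ℕ : Filter ℕ), ω n ∈ A n}

lemma internal_compl (A : ∀ n, Set (Y n)) : (internal A)ᶜ = internal fun n => (A n)ᶜ :=
  Set.ext fun _ => Ultrafilter.eventually_not.symm

lemma internal_union (A B : ∀ n, Set (Y n)) :
    internal A ∪ internal B = internal fun n => A n ∪ B n :=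
  Set.ext fun _ => Ultrafilter.eventually_or.symm

lemma internal_inter (A B : ∀ n, Set (Y n)) :
    internal A ∩ internal B = internal fun n => A n ∩ B n :=
  Set.ext fun _ => eventually_and.symm

lemma internal_univ : internal (fun n => (Set.univ : Set (Y n))) = Set.univ := by
  ext
  simp [internal]

lemma internal_empty : internal (fun n => (∅ : Set (Y n))) = ∅ := by
  simpa [internal_univ] using (internal_compl fun n => (Set.univ : Set (Y n))).symm

lemma internal_sdiff (A B : ∀ n, Set (Y n)) :
    internal A \ internal B = internal fun n => A n \ B n := by
  simp only [Set.sdiff_eq, internal_compl, internal_inter]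

lemma internal_biInter {ι : Type*} (t : Finset ι) (A : ι → ∀ n, Set (Y n)) :
    ⋂ i ∈ t, internal (A i) = internal fun n => ⋂ i ∈ t, A i n := by
  ext ω
  simp only [internal, Set.mem_iInter, Set.mem_ofPred_eq]
  exact (eventually_all_finset t).symm

lemma internal_iInter {ι : Type*} [Fintype ι] (A : ι → ∀ n, Set (Y n)) :
    ⋂ i, internal (A i) = internal fun n => ⋂ i, A i n := by
  simpa using internal_biInter Finset.univ A

lemma isSetAlgebra_range_internal : IsSetAlgebra (Set.range (internal (Y := Y))) where
  empty_mem := ⟨_, internal_empty⟩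
  compl_mem := by
    rintro _ ⟨A, rfl⟩
    exact ⟨_, (internal_compl A).symm⟩
  union_mem := by
    rintro _ _ ⟨A, rfl⟩ ⟨B, rfl⟩
    exact ⟨_, (internal_union A B).symm⟩

lemma eventually_nonempty_of_internal_nonempty {A : ∀ n, Set (Y n)} (h : (internal A).Nonempty) :
    ∀ᶠ n in (hyperfilter ℕ : Filter ℕ), (A n).Nonempty := by
  obtain ⟨ω, hω⟩ := h
  exact hω.mono fun n hn => ⟨_, hn⟩

variable [∀ n, Nonempty (Y n)]

lemma internal_nonempty {A : ∀ n, Set (Y n)}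
    (h : ∀ᶠ n in (hyperfilter ℕ : Filter ℕ), (A n).Nonempty) : (internal A).Nonempty := by
  classical
  refine ⟨fun n => if hn : (A n).Nonempty then hn.some else Classical.arbitrary _,
    h.mono fun n hn => ?_⟩
  simp only [dif_pos hn]
  exact hn.some_mem

lemma eventually_eq_empty_of_internal {A : ∀ n, Set (Y n)} (h : internal A = ∅) :
    ∀ᶠ n in (hyperfilter ℕ : Filter ℕ), A n = ∅ := by
  by_contra hA
  refine (internal_nonempty ?_).ne_empty h
  exact (Ultrafilter.eventually_not.2 hA).mono fun n hn => Set.nonempty_iff_ne_empty.2 hn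

lemma eventually_subset_of_internal_subset {A B : ∀ n, Set (Y n)} (h : internal A ⊆ internal B) :
    ∀ᶠ n in (hyperfilter ℕ : Filter ℕ), A n ⊆ B n := by
  rw [← Set.sdiff_eq_empty, internal_sdiff] at h
  exact (eventually_eq_empty_of_internal h).mono fun n hn => Set.sdiff_eq_empty.1 hn

/-- Countable saturation. -/
lemma iInter_internal_nonempty (A : ℕ → ∀ n, Set (Y n)) (hA : Antitone fun k => internal (A k))
    (hne : ∀ k, (internal (A k)).Nonempty) : (⋂ k, internal (A k)).Nonempty := by
  classical
  let B : ℕ → ∀ n, Set (Y n) := fun k n => ⋂ j ∈ Finset.range (k + 1), A j n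
  have hB : ∀ k, ∀ᶠ n in (hyperfilter ℕ : Filter ℕ), (B k n).Nonempty := by
    intro k
    refine eventually_nonempty_of_internal_nonempty ((hne k).mono ?_)
    rw [← internal_biInter]
    exact Set.subset_iInter₂ fun j hj => hA (Nat.lt_succ_iff.1 (Finset.mem_range.1 hj))
  let K : ℕ → ℕ := fun n => Nat.findGreatest (fun k => (B k n).Nonempty) n
  refine ⟨fun n => if hn : (B (K n) n).Nonempty then hn.some else Classical.arbitrary _,
    Set.mem_iInter.2 fun k => ?_⟩
  have hk : ∀ᶠ n in (hyperfilter ℕ : Filter ℕ), k ≤ n :=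
    Nat.hyperfilter_le_atTop (eventually_ge_atTop k)
  filter_upwards [hB k, hk] with n hn hkn
  have hKn : (B (K n) n).Nonempty := Nat.findGreatest_spec (P := fun k => (B k n).Nonempty) hkn hn
  have hkK : k ≤ K n := Nat.le_findGreatest hkn hn
  simp only [dif_pos hKn]
  exact Set.mem_iInter₂.1 hKn.some_mem k (Finset.mem_range.2 (Nat.lt_succ_of_le hkK))

variable [∀ n, MeasurableSpace (Y n)] [∀ n, DiscreteMeasurableSpace (Y n)]

/-- The Loeb measure of a sequence of probability spaces. -/
lemma exists_loeb_measure (P : ∀ n, Measure (Y n)) [∀ n, IsProbabilityMeasure (P n)] :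
    ∃ (_ : MeasurableSpace (∀ n, Y n)) (μ : Measure (∀ n, Y n)), IsProbabilityMeasure μ ∧
      ∀ A : ∀ n, Set (Y n), MeasurableSet (internal A) ∧
        Tendsto (fun n => P n (A n)) (hyperfilter ℕ) (𝓝 (μ (internal A))) := by
  classical
  let L : (∀ n, Set (Y n)) → ℝ≥0∞ := fun A => ((hyperfilter ℕ).map fun n => P n (A n)).lim
  have hL : ∀ A, Tendsto (fun n => P n (A n)) (hyperfilter ℕ) (𝓝 (L A)) := fun A =>
    Ultrafilter.le_nhds_lim ((hyperfilter ℕ).map fun n => P n (A n))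
  let m : Set (∀ n, Y n) → ℝ≥0∞ := fun s => if h : ∃ A, internal A = s then L h.choose else 0
  have hm : ∀ A, m (internal A) = L A := by
    intro A
    have h : ∃ A', internal A' = internal A := ⟨A, rfl⟩
    have hc := h.choose_spec
    simp only [m, dif_pos h]
    refine tendsto_nhds_unique (hL _) ((hL A).congr' ?_)
    filter_upwards [eventually_subset_of_internal_subset hc.le,
      eventually_subset_of_internal_subset hc.ge] with n h1 h2
    rw [h1.antisymm h2]
  have hring : IsSetRing (Set.range (internal (Y := Y))) := isSetAlgebra_range_internal.isSetRing
  have hm0 : m ∅ = 0 := by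
    rw [← internal_empty, hm]
    exact tendsto_nhds_unique (hL _) (by simp)
  let ν : AddContent ℝ≥0∞ (Set.range (internal (Y := Y))) := hring.addContent_of_union m hm0 (by
    rintro _ _ ⟨A, rfl⟩ ⟨B, rfl⟩ hAB
    rw [internal_union, hm, hm, hm]
    refine tendsto_nhds_unique (hL _) (((hL A).add (hL B)).congr' ?_)
    rw [Set.disjoint_iff_inter_eq_empty, internal_inter] at hAB
    filter_upwards [eventually_eq_empty_of_internal hAB] with n hn
    exact (measure_union (Set.disjoint_iff_inter_eq_empty.2 hn) (.of_discrete)).symm)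
  have hν : ∀ A, ν (internal A) = L A := hm
  have hL1 : ∀ A, L A ≤ 1 := fun A => le_of_tendsto' (hL A) fun n => prob_le_one
  have hsub : ν.IsSigmaSubadditive := by
    refine isSigmaSubadditive_of_addContent_iUnion_eq_tsum hring fun f hf hU hd =>
      addContent_iUnion_eq_sum_of_tendsto_zero hring ν ?_ ?_ hf hU hd
    · rintro _ ⟨A, rfl⟩
      rw [hν]
      exact ((hL1 A).trans_lt ENNReal.one_lt_top).ne
    · intro s hs hanti hempty
      choose A hA using hs
      obtain rfl : (fun k => internal (A k)) = s := funext hA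
      obtain ⟨k, hk⟩ : ∃ k, internal (A k) = ∅ := by
        by_contra! h
        exact (iInter_internal_nonempty A hanti h).ne_empty hempty
      refine tendsto_const_nhds.congr' ?_
      filter_upwards [eventually_ge_atTop k] with j hj
      have : internal (A j) = ∅ := Set.subset_empty_iff.1 ((hanti hj).trans hk.le)
      rw [this]
      exact addContent_empty.symm
  let _ : MeasurableSpace (∀ n, Y n) :=
    MeasurableSpace.generateFrom (Set.range (internal (Y := Y)))
  have hμ : ∀ A, ν.measure hring.isSetSemiring le_rfl hsub (internal A) = L A := fun A =>
    (ν.measure_eq hring.isSetSemiring rfl hsub ⟨A, rfl⟩).trans (hν A)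
  refine ⟨_, ν.measure hring.isSetSemiring le_rfl hsub, ⟨?_⟩, fun A =>
    ⟨MeasurableSpace.measurableSet_generateFrom ⟨A, rfl⟩, (hμ A).symm ▸ hL A⟩⟩
  rw [← internal_univ, hμ]
  exact tendsto_nhds_unique (hL _) (by simp)

end Loeb

section Density

/-- The density of a set in a finite type. -/
noncomputable def dens {α : Type*} (s : Set α) : ℝ := s.ncard / Nat.card α

lemma dens_eq_sum {α : Type*} [Fintype α] (s : Set α) :
    dens s = (∑ x, s.indicator (fun _ => (1 : ℝ)) x) / Fintype.card α := by
  classical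
  rw [dens, Nat.card_eq_fintype_card, Set.ncard_eq_toFinset_card']
  congr 1
  simp [Set.indicator_apply, Finset.sum_boole, Set.toFinset]

/-- The Loeb measure of a sequence of finite sets with their uniform densities. -/
lemma exists_loeb_measure_dens (Y : ℕ → Type*) [∀ n, Fintype (Y n)] [∀ n, Nonempty (Y n)] :
    ∃ (_ : MeasurableSpace (∀ n, Y n)) (μ : Measure (∀ n, Y n)), IsProbabilityMeasure μ ∧
      ∀ A : ∀ n, Set (Y n), MeasurableSet (internal A) ∧
        Tendsto (fun n => dens (A n)) (hyperfilter ℕ) (𝓝 (μ.real (internal A))) := by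
  let _ : ∀ n, MeasurableSpace (Y n) := fun n => ⊤
  have hdens : ∀ n (s : Set (Y n)), dens s = (uniformOn (Set.univ : Set (Y n)) s).toReal := by
    intro n s
    rw [uniformOn_univ, ENNReal.toReal_div, Measure.count_apply_finite _ s.toFinite, dens,
      Set.ncard_eq_toFinset_card _ s.toFinite]
    simp
  have : ∀ n, IsProbabilityMeasure (uniformOn (Set.univ : Set (Y n))) := fun n =>
    isProbabilityMeasure_uniformOn Set.finite_univ Set.univ_nonempty
  obtain ⟨m, μ, hμ, h⟩ := exists_loeb_measure fun n => uniformOn (Set.univ : Set (Y n))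
  refine ⟨m, μ, hμ, fun A => ⟨(h A).1, ?_⟩⟩
  simp only [hdens]
  exact (ENNReal.tendsto_toReal (measure_ne_top _ _)).comp (h A).2

end Density

section Product

variable {V : Type*}

lemma isSetAlgebra_dependsOn {X : V → Type*} (g : Finset V) :
    IsSetAlgebra {s : Set (∀ v, X v) | DependsOn (· ∈ s) (g : Set V)} where
  empty_mem _ _ _ := rfl
  compl_mem _ hs _ _ h := congrArg Not (hs h)
  union_mem _ _ hs ht _ _ h := congrArg₂ Or (hs h) (ht h)

/-- Replacing the coordinates outside `S` by a suitable fixed point does not decrease the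
correlation of a function of the coordinates in `S` with an intersection of sets. -/
lemma exists_slice [Fintype V] [DecidableEq V] {X : V → Type*} [∀ v, Fintype (X v)]
    [∀ v, Nonempty (X v)]
    (S : Finset V) {J : Type*} [Fintype J] (c : J → ℝ) (F : J → Set (∀ v, X v))
    (hF : ∀ j, DependsOn (· ∈ F j) (S : Set V)) (t : Finset (Finset V))
    (C : Finset V → Set (∀ v, X v)) (hC : ∀ h ∈ t, DependsOn (· ∈ C h) (h : Set V)) :
    ∃ C' : Finset V → Set (∀ v, X v),
      (∀ h ∈ t, DependsOn (· ∈ C' h) ((h ∩ S : Finset V) : Set V)) ∧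
      ∑ j, c j * dens (F j ∩ ⋂ h ∈ t, C h) ≤ ∑ j, c j * dens (F j ∩ ⋂ h ∈ t, C' h) := by
  classical
  let f : (∀ v, X v) → ℝ := fun x =>
    ∑ j, c j * (F j ∩ ⋂ h ∈ t, C h).indicator (fun _ => (1 : ℝ)) x
  have hinv : Function.Involutive fun p : (∀ v, X v) × (∀ v, X v) =>
      (S.piecewise p.1 p.2, S.piecewise p.2 p.1) := by
    rintro ⟨x, y⟩
    ext v <;> by_cases hv : v ∈ S <;> simp [hv]
  have hsum : ∑ y : (∀ v, X v), ∑ x, f x = ∑ y, ∑ x, f (S.piecewise x y) := by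
    rw [← Fintype.sum_prod_type_right' fun x (_ : ∀ v, X v) => f x,
      ← Fintype.sum_prod_type_right' fun x y => f (S.piecewise x y)]
    exact (Equiv.sum_comp hinv.toPerm fun p => f p.1).symm
  obtain ⟨y, -, hy⟩ := Finset.exists_le_of_sum_le Finset.univ_nonempty hsum.le
  have hmem : ∀ j x, S.piecewise x y ∈ F j ↔ x ∈ F j := fun j x =>
    (hF j fun v hv => Finset.piecewise_eq_of_mem _ _ _ hv).to_iff
  refine ⟨fun h => {x | S.piecewise x y ∈ C h}, fun h hh x x' hxx' => ?_, ?_⟩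
  · refine hC h hh fun v hv => ?_
    by_cases hvS : v ∈ S
    · simpa [hvS] using hxx' v (by simpa [hvS] using hv)
    · simp [hvS]
  · have hval : ∀ K : Set (∀ v, X v), ∑ j, c j * dens (F j ∩ K) =
        (∑ x, ∑ j, c j * (F j ∩ K).indicator (fun _ => (1 : ℝ)) x) /
          Fintype.card (∀ v, X v) := by
      intro K
      rw [Finset.sum_comm, Finset.sum_div]
      refine Finset.sum_congr rfl fun j _ => ?_
      rw [dens_eq_sum, ← Finset.mul_sum, mul_div_assoc]
    rw [hval, hval]
    refine div_le_div_of_nonneg_right (hy.trans_eq ?_) (Nat.cast_nonneg _)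
    refine Finset.sum_congr rfl fun x _ => Finset.sum_congr rfl fun j _ => ?_
    congr 1
    simp only [Set.indicator_apply, Set.mem_inter_iff, hmem, Set.mem_iInter, Set.mem_ofPred_eq]

/-- The internal sets all of whose components only depend on the coordinates in `g`. -/
def internalOn (X : ℕ → V → Type*) (g : Finset V) : Set (Set (∀ n v, X n v)) :=
  {s | ∃ C : ∀ n, Set (∀ v, X n v), (∀ n, DependsOn (· ∈ C n) (g : Set V)) ∧ internal C = s}

lemma isSliceable_internalOn [Fintype V] [DecidableEq V] (X : ℕ → V → Type*)
    [∀ n v, Fintype (X n v)]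
    [∀ n v, Nonempty (X n v)] [MeasurableSpace (∀ n v, X n v)] {μ : Measure (∀ n v, X n v)}
    (hμ : ∀ C : ∀ n, Set (∀ v, X n v), MeasurableSet (internal C) ∧
      Tendsto (fun n => dens (C n)) (hyperfilter ℕ) (𝓝 (μ.real (internal C)))) :
    IsSliceable μ (internalOn X) where
  isSetAlgebra g :=
    { empty_mem := ⟨_, fun n => (isSetAlgebra_dependsOn g).empty_mem, internal_empty⟩
      compl_mem := by
        rintro _ ⟨C, hC, rfl⟩
        exact ⟨_, fun n => (isSetAlgebra_dependsOn g).compl_mem (hC n), (internal_compl C).symm⟩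
      union_mem := by
        rintro _ _ ⟨C, hC, rfl⟩ ⟨C', hC', rfl⟩
        exact ⟨_, fun n => (isSetAlgebra_dependsOn g).union_mem (hC n) (hC' n),
          (internal_union C C').symm⟩ }
  mono := by
    rintro g g' hg _ ⟨C, hC, rfl⟩
    exact ⟨C, fun n x y h => hC n fun v hv => h v (hg hv), rfl⟩
  measurableSet := by
    rintro g _ ⟨C, -, rfl⟩
    exact (hμ C).1
  slice := by
    intro S J _ c F hF t C hC
    choose F' hF' hFF' using hF
    obtain rfl : (fun j => internal (F' j)) = F := funext hFF'
    have : ∀ h, ∃ D : ∀ n, Set (∀ v, X n v), h ∈ t →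
        (∀ n, DependsOn (· ∈ D n) (h : Set V)) ∧ internal D = C h := by
      intro h
      by_cases hh : h ∈ t
      · obtain ⟨D, hD⟩ := hC h hh
        exact ⟨D, fun _ => hD⟩
      · exact ⟨fun _ => ∅, fun h' => absurd h' hh⟩
    choose D hD using this
    choose D' hD' hle using fun n => exists_slice S c (fun j => F' j n) (fun j => hF' j n) t
      (fun h => D h n) fun h hh => (hD h hh).1 n
    refine ⟨fun h => internal fun n => D' n h, fun h hh => ⟨_, fun n => hD' n h hh, rfl⟩, ?_⟩
    have hCD : ⋂ h ∈ t, C h = ⋂ h ∈ t, internal (D h) :=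
      Set.iInter₂_congr fun h hh => ((hD h hh).2).symm
    simp only [hCD, internal_biInter, internal_inter]
    exact le_of_tendsto_of_tendsto' (tendsto_finsetSum _ fun j _ => (hμ _).2.const_mul (c j))
      (tendsto_finsetSum _ fun j _ => (hμ _).2.const_mul (c j)) hle

end Product

/-- Removal along a sequence of product spaces in which the densities of the sets of simplices tend
to zero. -/
lemma exists_removal_of_tendsto {V : Type} [Fintype V] [DecidableEq V] (X : ℕ → V → Type)
    [∀ n v, Fintype (X n v)] [∀ n v, Nonempty (X n v)] (E : V → ∀ n, Set (∀ v, X n v))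
    (hE : ∀ i n, DependsOn (· ∈ E i n) ((Finset.univ.erase i : Finset V) : Set V))
    (h0 : Tendsto (fun n => dens (⋂ i, E i n)) atTop (𝓝 0)) {ε : ℝ} (hε : 0 < ε) :
    ∃ (n : ℕ) (F : V → Set (∀ v, X n v)),
      (∀ i, DependsOn (· ∈ F i) ((Finset.univ.erase i : Finset V) : Set V)) ∧
      (∀ i, dens (E i n \ F i) < ε) ∧ ⋂ i, F i = ∅ := by
  obtain ⟨_, μ, hμ, hdens⟩ := exists_loeb_measure_dens fun n => ∀ v, X n v
  have hE0 : μ (⋂ i, internal (E i)) = 0 := by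
    rw [internal_iInter, ← measureReal_eq_zero_iff]
    exact tendsto_nhds_unique (hdens _).2 (h0.mono_left Nat.hyperfilter_le_atTop)
  obtain ⟨F, hF, hEF, hF0⟩ := (isSliceable_internalOn X hdens).exists_removal
    (fun i => internal (E i)) (fun i => ⟨E i, hE i, rfl⟩) hE0 (half_pos hε)
  choose F' hFdep hFF' using hF
  obtain rfl : (fun i => internal (F' i)) = F := funext hFF'
  rw [internal_iInter] at hF0
  have hsmall : ∀ᶠ n in (hyperfilter ℕ : Filter ℕ), ∀ i, dens (E i n \ F' i n) < ε := by
    refine eventually_all.2 fun i => (hdens _).2.eventually_lt_const ?_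
    rw [← internal_sdiff]
    exact (hEF i).trans_lt (half_lt_self hε)
  obtain ⟨n, hn, hn0⟩ := (hsmall.and (eventually_eq_empty_of_internal hF0)).exists
  exact ⟨n, fun i => F' i n, fun i => hFdep i n, hn, hn0⟩

lemma card_le_dens_mul {V : Type*} [Fintype V] [DecidableEq V] {X : V → Type*}
    [∀ v, Fintype (X v)] [∀ v, Nonempty (X v)] (i : V)
    (K : Finset (∀ j : {j : V // j ≠ i}, X j.1)) (s : Set (∀ v, X v))
    (hs : ∀ x : ∀ v, X v, (fun j : {j : V // j ≠ i} => x j.1) ∈ K → x ∈ s) :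
    (K.card : ℝ) ≤ dens s * ∏ j : {j : V // j ≠ i}, (Fintype.card (X j.1) : ℝ) := by
  classical
  let e := Equiv.piSplitAt i X
  have hcard : (Nat.card (∀ v, X v) : ℝ) =
      Fintype.card (X i) * ∏ j : {j : V // j ≠ i}, (Fintype.card (X j.1) : ℝ) := by
    rw [Nat.card_eq_fintype_card, Fintype.card_congr e, Fintype.card_prod, Fintype.card_pi]
    push_cast
    rfl
  have hle : Fintype.card (X i) * K.card ≤ s.ncard := by
    rw [← Finset.card_univ, ← Finset.card_product, ← Set.ncard_coe_finset]
    refine Set.ncard_le_ncard_of_injOn e.symm (fun p hp => hs _ ?_) e.symm.injective.injOn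
      s.toFinite
    convert (Finset.mem_product.1 (Finset.mem_coe.1 hp)).2 using 1
    exact congrArg Prod.snd (e.apply_symm_apply p)
  have hle' : (Fintype.card (X i) : ℝ) * K.card ≤ s.ncard := by exact_mod_cast hle
  have hX : (0 : ℝ) < Fintype.card (X i) := by exact_mod_cast Fintype.card_pos
  have hP : (0 : ℝ) < ∏ j : {j : V // j ≠ i}, (Fintype.card (X j.1) : ℝ) :=
    Finset.prod_pos fun j _ => by exact_mod_cast Fintype.card_pos
  rw [dens, hcard, mul_comm (Fintype.card (X i) : ℝ), ← div_div, div_right_comm,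
    div_mul_cancel₀ _ hP.ne', le_div_iff₀ hX]
  linarith

end SimplexRemoval

open Finset

/-- **Theorem 10.1: the simplex removal lemma.**
A `(k+1)`-partite `k`-uniform hypergraph with vertex sets `X 0, …, X k` is modelled by giving,
for each `i : Fin (k+1)`, the finite set `H i` of its edges of index `[k+1] \ {i}`; such an edge
is a choice of one vertex in each part `X j` for `j ≠ i` (every edge of a `(k+1)`-partite
`k`-uniform hypergraph has index of this form).  A simplex is a point `x` of `∏ j, X j` all of
whose `k+1` faces are edges.  If `H` contains at most `c·∏ i, |X i|` simplices then one can,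
for each `i`, remove at most `a·∏_{j ≠ i} |X j|` edges of index `[k+1] \ {i}` so that the
remaining hypergraph `H'` is simplex-free. -/
theorem simplex_removal (k : ℕ) (hk : 0 < k) (a : ℝ) (ha : 0 < a) :
    ∃ c : ℝ, 0 < c ∧
      ∀ (X : Fin (k + 1) → Type) [∀ i, Fintype (X i)] [∀ i, DecidableEq (X i)]
        (H : ∀ i : Fin (k + 1), Finset ((j : {j : Fin (k + 1) // j ≠ i}) → X j.1)),
        ((univ.filter fun x : ∀ j, X j =>
            ∀ i, (fun j : {j : Fin (k + 1) // j ≠ i} => x j.1) ∈ H i).card : ℝ) ≤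
          c * ∏ i, (Fintype.card (X i) : ℝ) →
        ∃ H' : ∀ i : Fin (k + 1), Finset ((j : {j : Fin (k + 1) // j ≠ i}) → X j.1),
          (∀ i, H' i ⊆ H i) ∧
          (∀ x : ∀ j, X j, ¬ ∀ i, (fun j : {j : Fin (k + 1) // j ≠ i} => x j.1) ∈ H' i) ∧
          ∀ i, ((H i \ H' i).card : ℝ) ≤
            a * ∏ j : {j : Fin (k + 1) // j ≠ i}, (Fintype.card (X j.1) : ℝ) := by
  classical
  by_contra! hcon
  choose X hXf hXd H hle hbad using fun n : ℕ => hcon (1 / ((n : ℝ) + 1)) (by positivity)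
  have hne : ∀ n v, Nonempty (X n v) := by
    intro n v
    by_contra hv
    rw [not_nonempty_iff] at hv
    obtain ⟨i, hi⟩ := hbad n (H n) (fun _ => subset_rfl) fun x => isEmptyElim (x v)
    rw [sdiff_self, bot_eq_empty, card_empty, Nat.cast_zero] at hi
    exact absurd hi (not_lt.2 (by positivity))
  let E : Fin (k + 1) → ∀ n, Set (∀ v, X n v) := fun i n =>
    {x | (fun j : {j : Fin (k + 1) // j ≠ i} => x j.1) ∈ H n i}
  have hE : ∀ i n, DependsOn (· ∈ E i n) ((univ.erase i : Finset (Fin (k + 1))) : Set _) := by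
    intro i n x y h
    have hxy : (fun j : {j : Fin (k + 1) // j ≠ i} => x j.1) =
        fun j : {j : Fin (k + 1) // j ≠ i} => y j.1 :=
      funext fun j => h j.1 (mem_coe.2 (mem_erase.2 ⟨j.2, mem_univ _⟩))
    exact congrArg (· ∈ H n i) hxy
  have hE0 : Filter.Tendsto (fun n => SimplexRemoval.dens (⋂ i, E i n)) Filter.atTop (nhds 0) := by
    refine squeeze_zero (fun n => div_nonneg (Nat.cast_nonneg _) (Nat.cast_nonneg _))
      (fun n => ?_) tendsto_one_div_add_atTop_nhds_zero_nat
    have hset : ⋂ i, E i n = ↑(univ.filter fun x : ∀ j, X n j =>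
        ∀ i, (fun j : {j : Fin (k + 1) // j ≠ i} => x j.1) ∈ H n i) := by
      ext x
      simp [E]
    have hpos : (0 : ℝ) < ∏ v, (Fintype.card (X n v) : ℝ) :=
      prod_pos fun v _ => by exact_mod_cast Fintype.card_pos
    rw [SimplexRemoval.dens, hset, Set.ncard_coe_finset, Nat.card_eq_fintype_card,
      Fintype.card_pi, Nat.cast_prod, div_le_iff₀ hpos]
    exact hle n
  obtain ⟨n, F, hF, hEF, hF0⟩ := SimplexRemoval.exists_removal_of_tendsto X E hE hE0 ha
  let H' : ∀ i, Finset (∀ j : {j : Fin (k + 1) // j ≠ i}, X n j.1) := fun i =>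
    (H n i).filter fun y => ∃ x ∈ F i, (fun j : {j : Fin (k + 1) // j ≠ i} => x j.1) = y
  obtain ⟨i, hi⟩ := hbad n H' (fun i => filter_subset _ _) fun x => by
    by_contra! hx
    refine Set.notMem_empty x (hF0 ▸ Set.mem_iInter.2 fun i => ?_)
    obtain ⟨-, x', hx', hxx'⟩ := mem_filter.1 (hx i)
    refine (hF i fun v hv => ?_).mp hx'
    exact congrFun hxx' ⟨v, (mem_erase.1 (mem_coe.1 hv)).1⟩
  refine absurd hi (not_lt.2 ?_)
  refine (SimplexRemoval.card_le_dens_mul i _ (E i n \ F i) fun x hx => ?_).trans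
    (mul_le_mul_of_nonneg_right (hEF i).le (by positivity))
  obtain ⟨h1, h2⟩ := mem_sdiff.1 hx
  exact ⟨h1, fun hxF => h2 (mem_filter.2 ⟨h1, x, hxF, rfl⟩)⟩
end
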